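/- For every k ≥ 4 and every k-uniform hypergraph H with m(H) ≤ m_k(K_3^{+k}, C_{t_k}), there exists a 2-colouring of the edges of H with colours red and blue containing no red copy of K_3^{+k} and no blue copy of C_{t_k}; that is, H ↛ (K_3^{+k}, C_{t_k}). -/

import Mathlib

open scoped Classical

namespace ARR

/-- The vertex support of a hypergraph given by its edge set. -/
def vset (G : Finset (Finset ℕ)) : Finset ℕ := G.sup id

/-- Number of vertices of a hypergraph. -/
def vcount (G : Finset (Finset ℕ)) : ℕ := (vset G).card

/-- `G` is a `k`-uniform hypergraph. -/
def IsUniform (k : ℕ) (G : Finset (Finset ℕ)) : Prop := ∀ e ∈ G, e.card = k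

/-- The `k`-density `d_k`. -/
noncomputable def dk (k : ℕ) (G : Finset (Finset ℕ)) : ℝ :=
  if G.card = 0 then 0
  else if G.card = 1 ∧ vcount G = k then 1 / (k : ℝ)
  else ((G.card : ℝ) - 1) / ((vcount G : ℝ) - (k : ℝ))

/-- The `k`-density `m_k`: the maximum of `d_k` over subgraphs. -/
noncomputable def mk (k : ℕ) (G : Finset (Finset ℕ)) : ℝ :=
  sSup {x : ℝ | ∃ H ⊆ G, x = dk k H}

/-- The usual density `m(G)`. -/
noncomputable def mDens (G : Finset (Finset ℕ)) : ℝ :=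
  sSup {x : ℝ | ∃ H ⊆ G, 1 ≤ vcount H ∧ x = (H.card : ℝ) / (vcount H : ℝ)}

/-- `G` is strictly `k`-balanced: every proper subgraph has strictly smaller `k`-density. -/
def StrictlyKBalanced (k : ℕ) (G : Finset (Finset ℕ)) : Prop :=
  ∀ H ⊆ G, H ≠ G → dk k H < dk k G

/-- The asymmetric `k`-density `m_k(F₁,F₂)`. -/
noncomputable def mkA (k : ℕ) (F1 F2 : Finset (Finset ℕ)) : ℝ :=
  sSup {x : ℝ | ∃ H ⊆ F1, H.Nonempty ∧
    x = (H.card : ℝ) / ((vcount H : ℝ) - (k : ℝ) + 1 / mk k F2)}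

/-- `F₁` is strictly balanced with respect to `m_k(·, F₂)`. -/
def StrictlyBalancedWrt (k : ℕ) (F1 F2 : Finset (Finset ℕ)) : Prop :=
  ∀ H ⊆ F1, H.Nonempty → H ≠ F1 →
    (H.card : ℝ) / ((vcount H : ℝ) - (k : ℝ) + 1 / mk k F2) < mkA k F1 F2

/-- `F'` is a copy of `F` (an isomorphic image of `F`). -/
def IsCopy (F F' : Finset (Finset ℕ)) : Prop :=
  ∃ f : ℕ → ℕ, Set.InjOn f ↑(vset F) ∧ F' = F.image (Finset.image f)

/-- `G` contains a copy of `F`. -/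
def ContainsCopy (G F : Finset (Finset ℕ)) : Prop := ∃ F' ⊆ G, IsCopy F F'

/-- Asymmetric Ramsey arrow `G → (F₁, …, F_r)`. -/
def Arrow {r : ℕ} (G : Finset (Finset ℕ)) (F : Fin r → Finset (Finset ℕ)) : Prop :=
  ∀ χ : Finset ℕ → Fin r, ∃ i : Fin r, ∃ F' ⊆ G, IsCopy (F i) F' ∧ ∀ e ∈ F', χ e = i

/-- Symmetric Ramsey arrow `G → (F)_r`. -/
def ArrowSym (G F : Finset (Finset ℕ)) (r : ℕ) : Prop :=
  ∀ χ : Finset ℕ → Fin r, ∃ i : Fin r, ∃ F' ⊆ G, IsCopy F F' ∧ ∀ e ∈ F', χ e = i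

/-- Two-colour asymmetric arrow `G → (F₁, F₂)`. -/
def Arrow2 (G F1 F2 : Finset (Finset ℕ)) : Prop :=
  ∀ χ : Finset ℕ → Fin 2,
    (∃ F' ⊆ G, IsCopy F1 F' ∧ ∀ e ∈ F', χ e = 0) ∨
    (∃ F' ⊆ G, IsCopy F2 F' ∧ ∀ e ∈ F', χ e = 1)

/-- The edge set of the complete `k`-uniform hypergraph on `{0, …, n-1}`. -/
def allEdges (k n : ℕ) : Finset (Finset ℕ) := (Finset.range n).powersetCard k

/-- Probability that the binomial random hypergraph `H^k(n,p)` satisfies property `P`. -/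
noncomputable def prob (k n : ℕ) (p : ℝ) (P : Finset (Finset ℕ) → Prop) : ℝ :=
  ∑ G ∈ (allEdges k n).powerset,
    if P G then p ^ G.card * (1 - p) ^ ((allEdges k n).card - G.card) else 0

/-- Expected number of members of a family `𝓕` which appear as subgraphs of `H^k(n,p)`. -/
noncomputable def expectCount (k n : ℕ) (p : ℝ) (𝓕 : Finset (Finset (Finset ℕ))) : ℝ :=
  ∑ G ∈ (allEdges k n).powerset,
    (p ^ G.card * (1 - p) ^ ((allEdges k n).card - G.card)) *
      ((𝓕.filter (fun F => F ⊆ G)).card : ℝ)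

/-- `K₃^{+k}`: the triangle on `{0,1,2}` with the `k-2` vertices `{3,…,k}` added to each edge. -/
def K3plus (k : ℕ) : Finset (Finset ℕ) :=
  {({0, 1} : Finset ℕ) ∪ (Finset.range (k + 1)).filter (fun x => 3 ≤ x),
   ({0, 2} : Finset ℕ) ∪ (Finset.range (k + 1)).filter (fun x => 3 ≤ x),
   ({1, 2} : Finset ℕ) ∪ (Finset.range (k + 1)).filter (fun x => 3 ≤ x)}

/-- The `i`-th edge `{i, i+1, …, i+k-1}` (mod `t`) of the tight cycle on `t` vertices. -/
def cycEdge (k t i : ℕ) : Finset ℕ := (Finset.range k).image (fun j => (i + j) % t)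

/-- The tight cycle `C_t` (k-uniform) on vertex set `{0, …, t-1}`. -/
def tightCycle (k t : ℕ) : Finset (Finset ℕ) := (Finset.range t).image (cycEdge k t)

/-- The tight path `T^k_ℓ` on vertex set `{0, …, ℓ-1}`. -/
def tightPath (k l : ℕ) : Finset (Finset ℕ) :=
  (Finset.range (l - k + 1)).image (fun i => (Finset.range k).image (fun j => i + j))

/-- The cycle length `t_k`: `t₄ = 8`, `t₅ = 14`, and `t_k = k²` for `k ≥ 6`. -/
def tk (k : ℕ) : ℕ := if k = 4 then 8 else if k = 5 then 14 else k ^ 2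

/-- Shift all vertices of a hypergraph by `a` (used to form vertex-disjoint unions). -/
def shiftHG (a : ℕ) (G : Finset (Finset ℕ)) : Finset (Finset ℕ) :=
  G.image (Finset.image (· + a))

/-- A set of edges is `m`-intersecting if any two distinct edges meet in at most `m` vertices. -/
def IntersectingLE (m : ℕ) (S : Finset (Finset ℕ)) : Prop :=
  ∀ e ∈ S, ∀ f ∈ S, e ≠ f → (e ∩ f).card ≤ m

/-- `e₀` is an attachment edge of `Fst` as a member of the family `F*(F₁,F₂)`. -/
def IsAttachment (F1 F2 Fst : Finset (Finset ℕ)) (e0 : Finset ℕ) : Prop :=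
  ∃ F2' : Finset (Finset ℕ), e0 ∈ F2' ∧ IsCopy F2 F2' ∧
    ∃ g : Finset ℕ → Finset (Finset ℕ),
      (∀ e ∈ F2'.erase e0, IsCopy F1 (g e) ∧ e ∈ g e) ∧
      Fst = F2' ∪ (F2'.erase e0).biUnion g

/-- `Fst` is a member of the family `F*(F₁,F₂)`. -/
def IsFStar (F1 F2 Fst : Finset (Finset ℕ)) : Prop := ∃ e0, IsAttachment F1 F2 Fst e0

/-- `Fst` is a generic member of `F*(F₁,F₂)`. -/
def IsGeneric (F1 F2 Fst : Finset (Finset ℕ)) : Prop :=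
  ∃ F2' : Finset (Finset ℕ), ∃ e0 ∈ F2', IsCopy F2 F2' ∧
    ∃ g : Finset ℕ → Finset (Finset ℕ),
      (∀ e ∈ F2'.erase e0, IsCopy F1 (g e) ∧ e ∈ g e) ∧
      Fst = F2' ∪ (F2'.erase e0).biUnion g ∧
      (∀ e ∈ F2'.erase e0, vset (g e) ∩ vset F2' = e) ∧
      (∀ e ∈ F2'.erase e0, ∀ e' ∈ F2'.erase e0, e ≠ e' →
        (vset (g e) \ e) ∩ (vset (g e') \ e') = ∅)

/-- The family `F*(F₁,F₂)` is asymmetric-balanced. -/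
def AsymBalanced (k : ℕ) (F1 F2 : Finset (Finset ℕ)) : Prop :=
  ∀ Fst, IsFStar F1 F2 Fst →
    ∀ H ⊆ Fst, vset H ⊂ vset Fst → (∃ e0 ∈ H, IsAttachment F1 F2 Fst e0) →
      mkA k F1 F2 ≤ ((Fst.card : ℝ) - (H.card : ℝ)) / ((vcount Fst : ℝ) - (vcount H : ℝ)) ∧
      (((Fst.card : ℝ) - (H.card : ℝ)) / ((vcount Fst : ℝ) - (vcount H : ℝ)) = mkA k F1 F2 →
        (∃ e0, IsAttachment F1 F2 Fst e0 ∧ H = {e0}) ∧ IsGeneric F1 F2 Fst)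

/-- An edge `e` of `G` is closed (w.r.t. `F₁`, `F₂`): it lies in a copy of `F₁` and a copy
of `F₂` inside `G` whose edge sets intersect exactly in `{e}`. -/
def ClosedEdge (F1 F2 G : Finset (Finset ℕ)) (e : Finset ℕ) : Prop :=
  ∃ A ⊆ G, ∃ B ⊆ G, IsCopy F1 A ∧ IsCopy F2 B ∧ A ∩ B = {e}

/-- Every edge of `G` is closed within `G`. -/
def SelfClosed (F1 F2 G : Finset (Finset ℕ)) : Prop := ∀ e ∈ G, ClosedEdge F1 F2 G e

/-- `Ĥ`: the subgraph of `H` obtained by repeatedly deleting open edges; equivalently the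
largest subgraph of `H` all of whose edges are closed within it. -/
noncomputable def hatH (F1 F2 H : Finset (Finset ℕ)) : Finset (Finset ℕ) :=
  (H.powerset.filter (fun G => SelfClosed F1 F2 G)).sup id

/-- `G'` is an `(F₁,F₂)`-core of `Ĥ`. -/
def IsCore (F1 F2 H G' : Finset (Finset ℕ)) : Prop :=
  G' ⊆ hatH F1 F2 H ∧
    ∀ A ⊆ hatH F1 F2 H, (IsCopy F1 A ∨ IsCopy F2 A) → (A ⊆ G' ∨ A ∩ G' = ∅)

/-- `G'` is a minimal (nonempty) closed `(F₁,F₂)`-core of `Ĥ`. -/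
def IsMinimalCore (F1 F2 H G' : Finset (Finset ℕ)) : Prop :=
  G'.Nonempty ∧ IsCore F1 F2 H G' ∧
    ∀ G'' ⊆ G', G''.Nonempty → G'' ≠ G' → ¬ IsCore F1 F2 H G''


def TP {α : Type} (d : α → α → ℕ) (k : ℕ) (Q : Finset α) (p : ℕ → α) : Prop :=
  (∀ i, i < k → p i ∈ Q) ∧ ∀ i j, i < k → j < k → d (p i) (p j) = (i - j) + (j - i)

def Ind {α : Type} (d : α → α → ℕ) (R : Finset α) : Prop := ∀ e ∈ R, ∀ f ∈ R, d e f ≠ 1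

def Met {α : Type} (d : α → α → ℕ) : Prop :=
  (∀ x y, d x y = 0 → x = y) ∧ (∀ x, d x x = 0) ∧ (∀ x y, d x y = d y x) ∧
    ∀ x y z, d x z ≤ d x y + d y z

section
variable {α : Type} {d : α → α → ℕ} {k : ℕ} {Q : Finset α} {p : ℕ → α}

theorem TP.rev (h : TP d k Q p) : TP d k Q (fun j => p (k - 1 - j)) := by
  refine ⟨fun i hi => h.1 _ (by omega), fun i j hi hj => ?_⟩
  have := h.2 (k-1-i) (k-1-j) (by omega) (by omega)
  simp only [this]; omega

theorem TP.inj (hd : Met d) (h : TP d k Q p) {i j : ℕ} (hi : i < k) (hj : j < k)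
    (e : p i = p j) : i = j := by
  have := h.2 i j hi hj
  rw [e, hd.2.1] at this
  omega

theorem TP.card (hd : Met d) (h : TP d k Q p) (I : Finset ℕ) (hI : I ⊆ Finset.range k) :
    (I.image p).card = I.card := by
  apply Finset.card_image_of_injOn
  intro i hi j hj e
  exact h.inj hd (Finset.mem_range.1 (hI hi)) (Finset.mem_range.1 (hI hj)) e

theorem TP.image_sub (h : TP d k Q p) : (Finset.range k).image p ⊆ Q := by
  intro x hx
  obtain ⟨i, hi, rfl⟩ := Finset.mem_image.1 hx
  exact h.1 i (Finset.mem_range.1 hi)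

theorem TP.surj (hd : Met d) (h : TP d k Q p) (hQ : Q.card ≤ k) {x : α} (hx : x ∈ Q) :
    ∃ i, i < k ∧ p i = x := by
  have h1 : (Finset.range k).image p = Q := by
    apply Finset.eq_of_subset_of_card_le h.image_sub
    rw [h.card hd _ (Finset.Subset.refl _)]; simpa using hQ
  rw [← h1] at hx
  obtain ⟨i, hi, rfl⟩ := Finset.mem_image.1 hx
  exact ⟨i, Finset.mem_range.1 hi, rfl⟩

/-- Independent index sets. -/
theorem idx_disj (I : Finset ℕ) (hI : ∀ i ∈ I, i + 1 ∉ I) : Disjoint I (I.image (· + 1)) := by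
  rw [Finset.disjoint_left]
  intro a ha hb
  obtain ⟨b, hb', rfl⟩ := Finset.mem_image.1 hb
  exact hI b hb' ha

theorem idx_card (I : Finset ℕ) (hk : ∀ i ∈ I, i < k) (hI : ∀ i ∈ I, i + 1 ∉ I)
    (M : Finset ℕ) (hM : ∀ m ∈ M, m ≤ k ∧ m ∉ I ∧ ∀ i ∈ I, i + 1 ≠ m) :
    2 * I.card + M.card ≤ k + 1 := by
  have h1 : (I.image (· + 1)).card = I.card :=
    Finset.card_image_of_injective _ (add_left_injective 1)
  have h2 := Finset.card_union_of_disjoint (idx_disj I hI)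
  have h3 : Disjoint (I ∪ I.image (· + 1)) M := by
    rw [Finset.disjoint_left]
    intro a ha hb
    obtain ⟨_, q, r⟩ := hM a hb
    rcases Finset.mem_union.1 ha with ha | ha
    · exact q ha
    · obtain ⟨b, hb', rfl⟩ := Finset.mem_image.1 ha
      exact r b hb' rfl
  have h4 := Finset.card_union_of_disjoint h3
  have h5 : (I ∪ I.image (· + 1)) ∪ M ⊆ Finset.range (k+1) := by
    intro a ha
    rw [Finset.mem_range]
    rcases Finset.mem_union.1 ha with ha | ha
    · rcases Finset.mem_union.1 ha with ha | ha
      · have := hk a ha; omega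
      · obtain ⟨b, hb, rfl⟩ := Finset.mem_image.1 ha
        have := hk b hb; show b + 1 < _; omega
    · have := (hM a ha).1; omega
  have h6 := Finset.card_le_card h5
  rw [Finset.card_range] at h6
  omega

/-- indices of `p` lying in `T` -/
noncomputable def idx (k : ℕ) (p : ℕ → α) (T : Finset α) : Finset ℕ :=
  (Finset.range k).filter (fun j => p j ∈ T)

theorem mem_idx {T : Finset α} {j : ℕ} : j ∈ idx k p T ↔ j < k ∧ p j ∈ T := by
  simp [idx]

theorem TP.idx_ind (h : TP d k Q p) {T : Finset α} (hT : Ind d T) :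
    ∀ i ∈ idx k p T, i + 1 ∉ idx k p T := by
  intro i hi hj
  rw [mem_idx] at hi hj
  have := h.2 i (i+1) hi.1 hj.1
  exact hT _ hi.2 _ hj.2 (by omega)

theorem TP.idx_card_le (h : TP d k Q p) {T : Finset α} (hT : Ind d T) :
    2 * (idx k p T).card ≤ k + 1 := by
  have := idx_card (k := k) (idx k p T) (fun i hi => (mem_idx.1 hi).1) (h.idx_ind hT) ∅ (by simp)
  simpa using this

theorem idx_full (hd : Met d) (h : TP d k Q p) {T : Finset α}
    (hs : ∀ x ∈ T, ∃ i, i < k ∧ p i = x) : (idx k p T).card = T.card := by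
  have : (idx k p T).image p = T := by
    ext x; constructor
    · intro hx
      obtain ⟨i, hi, rfl⟩ := Finset.mem_image.1 hx
      exact (mem_idx.1 hi).2
    · intro hx
      obtain ⟨i, hi, rfl⟩ := hs x hx
      exact Finset.mem_image.2 ⟨i, mem_idx.2 ⟨hi, hx⟩, rfl⟩
  rw [← h.card hd (idx k p T) (Finset.filter_subset _ _), this]

/-- odd `k`: forced alternation -/
theorem alt_odd (h : TP d k Q p) {T : Finset α} (hT : Ind d T)
    (hc : k + 1 ≤ 2 * (idx k p T).card) : ∀ j, j < k → (p j ∈ T ↔ Even j) := by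
  have key : ∀ m, m ≤ k → m ∈ idx k p T ∨ ∃ i ∈ idx k p T, i + 1 = m := by
    intro m hm
    by_contra hcon
    push Not at hcon
    have := idx_card (k := k) (idx k p T) (fun i hi => (mem_idx.1 hi).1) (h.idx_ind hT) {m}
      (by intro x hx; rw [Finset.mem_singleton] at hx; subst hx; exact ⟨hm, hcon.1, hcon.2⟩)
    rw [Finset.card_singleton] at this
    omega
  intro j
  induction j with
  | zero =>
    intro hj
    rcases key 0 (by omega) with h0 | ⟨i, _, h0⟩
    · simpa using (mem_idx.1 h0).2
    · omega
  | succ j ih =>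
    intro hj
    have ih := ih (by omega)
    rw [Nat.even_add_one, ← ih]
    constructor
    · intro a b
      exact h.idx_ind hT j (mem_idx.2 ⟨by omega, b⟩) (mem_idx.2 ⟨hj, a⟩)
    · intro a
      rcases key (j+1) (by omega) with h0 | ⟨i, hi, h0⟩
      · exact (mem_idx.1 h0).2
      · obtain rfl : i = j := by omega
        exact absurd (mem_idx.1 hi).2 a

theorem odd_final (hd : Met d) {Q1 Q2 Q3 : Finset α} {p q r : ℕ → α} (hk : 5 ≤ k) (hodd : Odd k)
    (hp : TP d k Q1 p) (hq : TP d k Q2 q) (hr : TP d k Q3 r)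
    (hpq : ∀ j, j < k → Odd j → p j = q j)
    (hro : ∀ j, j < k → Odd j → ∃ i, i < k ∧ Even i ∧ r j = p i)
    (h0 : ∃ i, i < k ∧ r i = q 0) (h1 : ∃ i, i < k ∧ r i = q (k-1)) : False := by
  wlog hw : r 0 = q 0 generalizing r
  · apply this hr.rev (r := fun j => r (k - 1 - j))
    · intro j hj hjo
      exact hro _ (by omega) (by rw [Nat.odd_iff] at *; omega)
    · obtain ⟨i, hi, e⟩ := h0
      exact ⟨k-1-i, by omega, by rw [← e]; congr 1; omega⟩
    · obtain ⟨i, hi, e⟩ := h1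
      exact ⟨k-1-i, by omega, by rw [← e]; congr 1; omega⟩
    · obtain ⟨i, hi, e⟩ := h0
      obtain ⟨j, hj, e'⟩ := h1
      have a := hq.2 0 (k-1) (by omega) (by omega)
      rw [← e, ← e', hr.2 i j hi hj] at a
      have : i ≠ 0 := by rintro rfl; exact hw e
      have : i = k - 1 := by omega
      subst this
      simpa using e
  have hw' : r (k-1) = q (k-1) := by
    obtain ⟨j, hj, e'⟩ := h1
    have a := hq.2 0 (k-1) (by omega) (by omega)
    rw [← hw, ← e', hr.2 0 j (by omega) hj] at a
    rw [← e']; congr 1; omega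
  have hk2 : Odd (k-2) := by rw [Nat.odd_iff] at *; omega
  obtain ⟨i, hi, hie, ei⟩ := hro 1 (by omega) (by decide)
  obtain ⟨j, hj, hje, ej⟩ := hro (k-2) (by omega) hk2
  rw [Nat.even_iff] at hie hje
  rw [Nat.odd_iff] at hodd
  have a1 := hq.2 0 (k-2) (by omega) (by omega)
  rw [← hpq _ (by omega) hk2, ← hw] at a1
  have a2 := hr.2 0 1 (by omega) (by omega)
  have a3 := hd.2.2.2 (r 0) (r 1) (p (k-2))
  rw [ei] at a3 a2
  rw [hp.2 i (k-2) hi (by omega)] at a3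
  have b1 := hq.2 (k-1) 1 (by omega) (by omega)
  rw [← hpq 1 (by omega) (by decide), ← hw'] at b1
  have b2 := hr.2 (k-1) (k-2) (by omega) (by omega)
  have b3 := hd.2.2.2 (r (k-1)) (r (k-2)) (p 1)
  rw [ej] at b3 b2
  rw [hp.2 j 1 hj (by omega)] at b3
  have c := hr.2 1 (k-2) (by omega) (by omega)
  rw [ei, ej, hp.2 i j hi hj] at c
  omega


theorem TP.ind_image (h : TP d k Q p) (I : Finset ℕ) (hI : I ⊆ Finset.range k)
    (hi : ∀ i ∈ I, i + 1 ∉ I) : Ind d (I.image p) := by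
  intro e he f hf
  obtain ⟨i, hi', rfl⟩ := Finset.mem_image.1 he
  obtain ⟨j, hj', rfl⟩ := Finset.mem_image.1 hf
  rw [h.2 i j (Finset.mem_range.1 (hI hi')) (Finset.mem_range.1 (hI hj'))]
  intro hc
  have : j = i + 1 ∨ i = j + 1 := by omega
  rcases this with rfl | rfl
  · exact hi _ hi' hj'
  · exact hi _ hj' hi'

def evI (k : ℕ) : Finset ℕ := (Finset.range ((k+1)/2)).image (fun i => 2 * i)
def odI (k : ℕ) : Finset ℕ := (Finset.range (k/2)).image (fun i => 2 * i + 1)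

theorem mem_evI {j : ℕ} : j ∈ evI k ↔ j < k ∧ j % 2 = 0 := by
  simp only [evI, Finset.mem_image, Finset.mem_range]
  constructor
  · rintro ⟨i, hi, rfl⟩; omega
  · intro h; exact ⟨j/2, by omega, by omega⟩

theorem mem_odI {j : ℕ} : j ∈ odI k ↔ j < k ∧ j % 2 = 1 := by
  simp only [odI, Finset.mem_image, Finset.mem_range]
  constructor
  · rintro ⟨i, hi, rfl⟩; omega
  · intro h; exact ⟨j/2, by omega, by omega⟩

theorem card_evI : (evI k).card = (k+1)/2 := by
  rw [evI, Finset.card_image_of_injective, Finset.card_range]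
  intro a b h; simpa using h

theorem card_odI : (odI k).card = k/2 := by
  rw [odI, Finset.card_image_of_injective, Finset.card_range]
  intro a b h; simpa using h

theorem evI_sub : evI k ⊆ Finset.range k := fun _ hj => Finset.mem_range.2 (mem_evI.1 hj).1
theorem odI_sub : odI k ⊆ Finset.range k := fun _ hj => Finset.mem_range.2 (mem_odI.1 hj).1

theorem evI_ind : ∀ i ∈ evI k, i + 1 ∉ evI k := by
  intro i hi; rw [mem_evI] at *; omega
theorem odI_ind : ∀ i ∈ odI k, i + 1 ∉ odI k := by
  intro i hi; rw [mem_odI] at *; omega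

theorem TP.mono {Q' : Finset α} (h : TP d k Q p) (hQ : Q ⊆ Q') : TP d k Q' p :=
  ⟨fun i hi => hQ (h.1 i hi), h.2⟩

theorem setup (hd : Met d) {S : Finset α} (hS : S.card ≤ k + (k+1)/2)
    (h : ∀ R ⊆ S, Ind d R → ∃ p, TP d k (S \ R) p) :
    ∃ T p, T ⊆ S ∧ Ind d T ∧ TP d k (S \ T) p ∧ T.card = (k+1)/2 ∧
      S \ T = (Finset.range k).image p ∧ S.card = k + (k+1)/2 := by
  obtain ⟨T, hT, hmax⟩ := Finset.exists_max_image (S.powerset.filter (Ind d)) Finset.card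
    ⟨∅, by simp [Ind]⟩
  rw [Finset.mem_filter, Finset.mem_powerset] at hT
  obtain ⟨p, hp⟩ := h T hT.1 hT.2
  have h1 := hmax ((evI k).image p) (by
    rw [Finset.mem_filter, Finset.mem_powerset]
    refine ⟨?_, hp.ind_image _ evI_sub evI_ind⟩
    exact (Finset.image_subset_image evI_sub).trans (hp.image_sub.trans Finset.sdiff_subset))
  rw [hp.card hd _ evI_sub, card_evI] at h1
  have h2 := Finset.card_le_card hp.image_sub
  rw [hp.card hd _ (Finset.Subset.refl _), Finset.card_range] at h2
  have h3 := Finset.card_sdiff_add_card_eq_card hT.1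
  refine ⟨T, p, hT.1, hT.2, hp, by omega, ?_, by omega⟩
  symm
  apply Finset.eq_of_subset_of_card_le hp.image_sub
  rw [hp.card hd _ (Finset.Subset.refl _), Finset.card_range]
  omega

theorem sub_of_sdiff {S T : Finset α} {p : ℕ → α} {k : ℕ}
    (hST : S \ T = (Finset.range k).image p) (I : Finset ℕ) (hI : I ⊆ Finset.range k) :
    I.image p ⊆ S :=
  (Finset.image_subset_image hI).trans (hST ▸ Finset.sdiff_subset)

theorem core_even (hd : Met d) {S : Finset α} (hk : 4 ≤ k) (hev : k % 2 = 0)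
    (hS : S.card ≤ k + (k+1)/2)
    (h : ∀ R ⊆ S, Ind d R → ∃ p, TP d k (S \ R) p) : False := by
  obtain ⟨T, p, hTS, hT, hp, hTc, hST, hSc⟩ := setup hd hS h
  have hTp : ∀ i, i < k → p i ∉ T := fun i hi => (Finset.mem_sdiff.1 (hp.1 i hi)).2
  have hcase : ∀ x ∈ S, x ∉ T → ∃ i, i < k ∧ p i = x := by
    intro x hx hxT
    have : x ∈ S \ T := Finset.mem_sdiff.2 ⟨hx, hxT⟩
    rw [hST] at this
    obtain ⟨i, hi, rfl⟩ := Finset.mem_image.1 this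
    exact ⟨i, Finset.mem_range.1 hi, rfl⟩
  -- first colouring
  have hE := sub_of_sdiff hST _ (evI_sub (k := k))
  obtain ⟨q, hq⟩ := h _ hE (hp.ind_image _ evI_sub evI_ind)
  have hqc : (S \ (evI k).image p).card ≤ k := by
    have := Finset.card_sdiff_add_card_eq_card hE
    rw [hp.card hd _ evI_sub, card_evI] at this
    omega
  have halt : ∀ j, j + 1 < k → (q j ∈ T ↔ q (j+1) ∉ T) := by
    intro j hj
    constructor
    · intro a b
      exact hq.idx_ind hT j (mem_idx.2 ⟨by omega, a⟩) (mem_idx.2 ⟨hj, b⟩)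
    · intro b
      by_contra a
      have := hq.2 j (j+1) (by omega) hj
      have m1 := Finset.mem_sdiff.1 (hq.1 j (by omega))
      have m2 := Finset.mem_sdiff.1 (hq.1 (j+1) hj)
      obtain ⟨i1, hi1, e1⟩ := hcase _ m1.1 a
      obtain ⟨i2, hi2, e2⟩ := hcase _ m2.1 b
      rw [← e1, ← e2, hp.2 _ _ hi1 hi2] at this
      have n1 : i1 % 2 ≠ 0 := fun hh =>
        m1.2 (Finset.mem_image.2 ⟨i1, mem_evI.2 ⟨hi1, hh⟩, e1⟩)
      have n2 : i2 % 2 ≠ 0 := fun hh =>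
        m2.2 (Finset.mem_image.2 ⟨i2, mem_evI.2 ⟨hi2, hh⟩, e2⟩)
      omega
  have halt2 : ∀ j, j < k → (q j ∈ T ↔ (q 0 ∈ T ↔ j % 2 = 0)) := by
    intro j
    induction j with
    | zero => intro _; simp
    | succ j ih =>
      intro hj
      have i1 := ih (by omega)
      have i2 := halt j hj
      have : (j + 1) % 2 = 0 ↔ ¬ (j % 2 = 0) := by omega
      rw [this]
      tauto
  have hsurj : ∀ x ∈ T, ∃ i, i < k ∧ q i = x := by
    intro x hx
    apply hq.surj hd hqc
    rw [Finset.mem_sdiff]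
    refine ⟨hTS hx, fun hc => ?_⟩
    obtain ⟨i, hi, rfl⟩ := Finset.mem_image.1 hc
    exact hTp i (mem_evI.1 hi).1 hx
  have hfar : ∀ x ∈ T, ∀ y ∈ T, d x y ≠ k - 1 := by
    intro x hx y hy hxy
    obtain ⟨i, hi, rfl⟩ := hsurj x hx
    obtain ⟨j, hj, rfl⟩ := hsurj y hy
    rw [hq.2 i j hi hj] at hxy
    rw [halt2 i hi] at hx
    rw [halt2 j hj] at hy
    have : i % 2 = 0 ↔ ¬ (j % 2 = 0) := by omega
    rw [this] at hx
    tauto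
  -- second colouring
  set I2 : Finset ℕ := insert 0 ((odI k).erase 1) with hI2
  have mI2 : ∀ j, j ∈ I2 ↔ j = 0 ∨ (j < k ∧ j % 2 = 1 ∧ j ≠ 1) := by
    intro j
    rw [hI2, Finset.mem_insert, Finset.mem_erase, mem_odI]
    tauto
  have I2s : I2 ⊆ Finset.range k := by
    intro j hj; rw [mI2] at hj; rw [Finset.mem_range]; omega
  have I2i : ∀ i ∈ I2, i + 1 ∉ I2 := by
    intro i hi hj; rw [mI2] at hi hj; omega
  have I2c : I2.card = k / 2 := by
    rw [hI2, Finset.card_insert_of_notMem, Finset.card_erase_of_mem, card_odI]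
    · omega
    · rw [mem_odI]; omega
    · rw [Finset.mem_erase, mem_odI]; omega
  have hE2 := sub_of_sdiff hST _ I2s
  obtain ⟨r, hr⟩ := h _ hE2 (hp.ind_image _ I2s I2i)
  have hrc : (S \ I2.image p).card ≤ k := by
    have := Finset.card_sdiff_add_card_eq_card hE2
    rw [hp.card hd _ I2s, I2c] at this
    omega
  have hrs : ∀ x ∈ T, ∃ i, i < k ∧ r i = x := by
    intro x hx
    apply hr.surj hd hrc
    rw [Finset.mem_sdiff]
    refine ⟨hTS hx, fun hc => ?_⟩
    obtain ⟨i, hi, rfl⟩ := Finset.mem_image.1 hc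
    exact hTp i (Finset.mem_range.1 (I2s hi)) hx
  have hrs2 : ∀ i, i < k → i ∉ I2 → ∃ j, j < k ∧ r j = p i := by
    intro i hi hni
    apply hr.surj hd hrc
    rw [Finset.mem_sdiff]
    refine ⟨(Finset.mem_sdiff.1 (hp.1 i hi)).1, fun hc => ?_⟩
    obtain ⟨i', hi', e⟩ := Finset.mem_image.1 hc
    have := hp.inj hd (Finset.mem_range.1 (I2s hi')) hi e
    subst this
    exact hni hi'
  obtain ⟨a, ha, ea⟩ := hrs2 1 (by omega) (by rw [mI2]; omega)
  obtain ⟨b, hb, eb⟩ := hrs2 2 (by omega) (by rw [mI2]; omega)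
  have hab : d (r a) (r b) = 1 := by rw [ea, eb, hp.2 1 2 (by omega) (by omega)]
  rw [hr.2 a b ha hb] at hab
  have haT : a ∉ idx k r T := by rw [mem_idx, ea]; exact fun hh => hTp 1 (by omega) hh.2
  have hbT : b ∉ idx k r T := by rw [mem_idx, eb]; exact fun hh => hTp 2 (by omega) hh.2
  obtain ⟨c, hc, hcT, hcT'⟩ : ∃ c, c + 1 < k ∧ c ∉ idx k r T ∧ c + 1 ∉ idx k r T := by
    have : b = a + 1 ∨ a = b + 1 := by omega
    rcases this with rfl | rfl
    · exact ⟨a, hb, haT, hbT⟩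
    · exact ⟨b, ha, hbT, haT⟩
  have hidx := idx_full hd hr hrs
  have hlast : k ∉ idx k r T := by rw [mem_idx]; omega
  have key : ∀ m, m ≤ k → m ≠ c + 1 → m ∈ idx k r T ∨ ∃ i ∈ idx k r T, i + 1 = m := by
    intro m hm hmc
    by_contra hcon
    push Not at hcon
    have := idx_card (k := k) (idx k r T) (fun i hi => (mem_idx.1 hi).1) (hr.idx_ind hT) {m, c+1}
      (by
        intro x hx
        rw [Finset.mem_insert, Finset.mem_singleton] at hx
        rcases hx with rfl | rfl
        · exact ⟨hm, hcon.1, hcon.2⟩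
        · refine ⟨by omega, hcT', fun i hi e => ?_⟩
          obtain rfl : i = c := by omega
          exact hcT hi)
    rw [Finset.card_pair hmc] at this
    omega
  have k0 : 0 ∈ idx k r T := by
    rcases key 0 (by omega) (by omega) with h0 | ⟨i, _, h0⟩
    · exact h0
    · omega
  have kl : k - 1 ∈ idx k r T := by
    rcases key k (by omega) (by omega) with h0 | ⟨i, hi, h0⟩
    · exact absurd h0 hlast
    · obtain rfl : i = k - 1 := by omega
      exact hi
  rw [mem_idx] at k0 kl
  apply hfar _ k0.2 _ kl.2
  rw [hr.2 0 (k-1) (by omega) (by omega)]; omega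

theorem core_odd (hd : Met d) {S : Finset α} (hk : 5 ≤ k) (hodd : k % 2 = 1)
    (hS : S.card ≤ k + (k+1)/2)
    (h : ∀ R ⊆ S, Ind d R → ∃ p, TP d k (S \ R) p) : False := by
  obtain ⟨T, p, hTS, hT, hp, hTc, hST, hSc⟩ := setup hd hS h
  have hko : Odd k := Nat.odd_iff.2 hodd
  have hTp : ∀ i, i < k → p i ∉ T := fun i hi => (Finset.mem_sdiff.1 (hp.1 i hi)).2
  have hcase : ∀ x ∈ S, x ∉ T → ∃ i, i < k ∧ p i = x := by
    intro x hx hxT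
    have : x ∈ S \ T := Finset.mem_sdiff.2 ⟨hx, hxT⟩
    rw [hST] at this
    obtain ⟨i, hi, rfl⟩ := Finset.mem_image.1 this
    exact ⟨i, Finset.mem_range.1 hi, rfl⟩
  have hE := sub_of_sdiff hST _ (evI_sub (k := k))
  have hEi := hp.ind_image _ evI_sub evI_ind
  have hEc := hp.card hd _ evI_sub
  rw [card_evI] at hEc
  obtain ⟨q, hq⟩ := h _ hE hEi
  have hqc : (S \ (evI k).image p).card ≤ k := by
    have := Finset.card_sdiff_add_card_eq_card hE
    omega
  have hsurjT : ∀ q, TP d k (S \ (evI k).image p) q → ∀ x ∈ T, ∃ i, i < k ∧ q i = x := by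
    intro q hq x hx
    apply hq.surj hd hqc
    rw [Finset.mem_sdiff]
    refine ⟨hTS hx, fun hc => ?_⟩
    obtain ⟨i, hi, rfl⟩ := Finset.mem_image.1 hc
    exact hTp i (mem_evI.1 hi).1 hx
  have haltT : ∀ q, TP d k (S \ (evI k).image p) q → ∀ j, j < k → (q j ∈ T ↔ Even j) := by
    intro q hq
    apply alt_odd hq hT
    rw [idx_full hd hq (hsurjT q hq)]; omega
  have hoddp : ∀ q, TP d k (S \ (evI k).image p) q → ∀ i, i < k → i % 2 = 1 →
      ∃ j, j < k ∧ j % 2 = 1 ∧ q j = p i := by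
    intro q hq i hi hio
    obtain ⟨j, hj, e⟩ := hq.surj hd hqc (x := p i) (by
      rw [Finset.mem_sdiff]
      refine ⟨(Finset.mem_sdiff.1 (hp.1 i hi)).1, fun hc => ?_⟩
      obtain ⟨i', hi', e⟩ := Finset.mem_image.1 hc
      have := hp.inj hd (mem_evI.1 hi').1 hi e
      rw [mem_evI] at hi'; omega)
    refine ⟨j, hj, ?_, e⟩
    have := haltT q hq j hj
    rw [e] at this
    have h2 := hTp i hi
    rw [Nat.even_iff] at this
    by_contra hc
    exact h2 (this.2 (by omega))
  obtain ⟨q, hq, hq1⟩ : ∃ q, TP d k (S \ (evI k).image p) q ∧ q 1 = p 1 := by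
    obtain ⟨a, ha, hao, ea⟩ := hoddp q hq 1 (by omega) (by omega)
    obtain ⟨b, hb, hbo, eb⟩ := hoddp q hq (k-2) (by omega) (by omega)
    have := hq.2 a b ha hb
    rw [ea, eb, hp.2 1 (k-2) (by omega) (by omega)] at this
    have : a = 1 ∨ a = k - 2 := by omega
    rcases this with rfl | rfl
    · exact ⟨q, hq, ea⟩
    · refine ⟨_, hq.rev, ?_⟩
      show q (k - 1 - 1) = _
      rw [← ea]; congr 1
  have hpq : ∀ j, j < k → Odd j → p j = q j := by
    intro j hj hjo
    rw [Nat.odd_iff] at hjo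
    obtain ⟨b, hb, hbo, eb⟩ := hoddp q hq j hj hjo
    have := hq.2 1 b (by omega) hb
    rw [hq1, eb, hp.2 1 j (by omega) hj] at this
    obtain rfl : b = j := by omega
    exact eb.symm
  have hO := sub_of_sdiff hST _ (odI_sub (k := k))
  obtain ⟨r, hr⟩ := h _ hO (hp.ind_image _ odI_sub odI_ind)
  have hrTE : ∀ j, j < k → r j ∈ T ∨ r j ∈ (evI k).image p := by
    intro j hj
    by_cases hjT : r j ∈ T
    · exact Or.inl hjT
    · right
      have m := Finset.mem_sdiff.1 (hr.1 j hj)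
      obtain ⟨i, hi, e⟩ := hcase _ m.1 hjT
      refine Finset.mem_image.2 ⟨i, mem_evI.2 ⟨hi, ?_⟩, e⟩
      by_contra hc
      exact m.2 (Finset.mem_image.2 ⟨i, mem_odI.2 ⟨hi, by omega⟩, e⟩)
  have hEp : ∀ x ∈ (evI k).image p, ∃ i, i < k ∧ Even i ∧ x = p i := by
    intro x hx
    obtain ⟨i, hi, rfl⟩ := Finset.mem_image.1 hx
    rw [mem_evI] at hi
    exact ⟨i, hi.1, Nat.even_iff.2 hi.2, rfl⟩
  have hTq : ∀ x ∈ T, ∃ i, i < k ∧ Even i ∧ x = q i := by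
    intro x hx
    obtain ⟨i, hi, rfl⟩ := hsurjT q hq x hx
    exact ⟨i, hi, (haltT q hq i hi).1 hx, rfl⟩
  have hsum : k ≤ (idx k r T).card + (idx k r ((evI k).image p)).card := by
    have hle : (Finset.range k).card ≤ (idx k r T ∪ idx k r ((evI k).image p)).card := by
      apply Finset.card_le_card
      intro j hj
      rw [Finset.mem_range] at hj
      rw [Finset.mem_union, mem_idx, mem_idx]
      rcases hrTE j hj with a | a
      · exact Or.inl ⟨hj, a⟩
      · exact Or.inr ⟨hj, a⟩
    rw [Finset.card_range] at hle
    exact hle.trans (Finset.card_union_le _ _)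
  -- surjectivity when index count is full
  have hfull : ∀ W : Finset α, W.card = (k+1)/2 → (k+1)/2 ≤ (idx k r W).card →
      ∀ x ∈ W, ∃ i, i < k ∧ r i = x := by
    intro W hW hc x hx
    have : (idx k r W).image r = W := by
      apply Finset.eq_of_subset_of_card_le
      · intro y hy
        obtain ⟨i, hi, rfl⟩ := Finset.mem_image.1 hy
        exact (mem_idx.1 hi).2
      · rw [hr.card hd (idx k r W) (Finset.filter_subset _ _)]; omega
    rw [← this] at hx
    obtain ⟨i, hi, rfl⟩ := Finset.mem_image.1 hx
    exact ⟨i, (mem_idx.1 hi).1, rfl⟩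
  have hk1 : Even (k-1) := by rw [Nat.even_iff]; omega
  by_cases hc : (k+1)/2 ≤ (idx k r T).card
  · have hf := hfull T hTc hc
    have ha := alt_odd hr hT (by omega)
    refine odd_final hd hk hko hp hq hr hpq ?_ (hf _ ?_) (hf _ ?_)
    · intro j hj hjo
      rcases hrTE j hj with a | a
      · exact absurd ((ha j hj).1 a) (by rwa [Nat.not_even_iff_odd])
      · exact hEp _ a
    · exact (haltT q hq 0 (by omega)).2 (by decide)
    · exact (haltT q hq (k-1) (by omega)).2 hk1
  · have hc' : (k+1)/2 ≤ (idx k r ((evI k).image p)).card := by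
      omega
    have hf := hfull _ hEc hc'
    have ha := alt_odd hr hEi (by omega)
    refine odd_final hd hk hko hq hp hr (fun j hj hjo => (hpq j hj hjo).symm) ?_ (hf _ ?_) (hf _ ?_)
    · intro j hj hjo
      rcases hrTE j hj with a | a
      · exact hTq _ a
      · exact absurd ((ha j hj).1 a) (by rwa [Nat.not_even_iff_odd])
    · exact Finset.mem_image.2 ⟨0, mem_evI.2 (by omega), rfl⟩
    · exact Finset.mem_image.2 ⟨k-1, mem_evI.2 (by omega), rfl⟩


theorem k4_caseB (hd : Met d) {S : Finset α}
    (h : ∀ R ⊆ S, Ind d R → ∃ p, TP d 4 (S \ R) p)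
    (hno : ∀ x ∈ S, ∀ y ∈ S, ∀ z ∈ S, 2 ≤ d x y → 2 ≤ d x z → 2 ≤ d y z → False)
    (hp : TP d 4 S p) (hQ : (S.filter (fun x => 2 ≤ d (p 0) x)).card ≤ 3) : False := by
  obtain ⟨d0, ds, dsym, dt⟩ := id hd
  have P := fun i hi => hp.1 i hi
  have struct : ∀ Q ⊆ S, ∀ q, TP d 4 Q q → ∃ q', TP d 4 Q q' ∧ 2 ≤ d (p 3) (q' 0) ∧
      2 ≤ d (p 3) (q' 1) ∧ 2 ≤ d (p 0) (q' 2) ∧ 2 ≤ d (p 0) (q' 3) := by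
    intro Q hQS q hq
    have or1 : ∀ j, j < 4 → 2 ≤ d (p 3) (q j) ∨ 2 ≤ d (p 0) (q j) := by
      intro j hj
      have a := dt (p 0) (q j) (p 3)
      rw [dsym (q j) (p 3), hp.2 0 3 (by omega) (by omega)] at a
      omega
    have c3 : ∀ i j, i < 4 → j < 4 → 2 ≤ (i - j) + (j - i) → 2 ≤ d (p 3) (q i) →
        2 ≤ d (p 3) (q j) → False := by
      intro i j hi hj hij a b
      exact hno _ (P 3 (by omega)) _ (hQS (hq.1 i hi)) _ (hQS (hq.1 j hj)) a b
        (by rw [hq.2 i j hi hj]; exact hij)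
    have c0 : ∀ i j, i < 4 → j < 4 → 2 ≤ (i - j) + (j - i) → 2 ≤ d (p 0) (q i) →
        2 ≤ d (p 0) (q j) → False := by
      intro i j hi hj hij a b
      exact hno _ (P 0 (by omega)) _ (hQS (hq.1 i hi)) _ (hQS (hq.1 j hj)) a b
        (by rw [hq.2 i j hi hj]; exact hij)
    have o0 := or1 0 (by omega)
    have o1 := or1 1 (by omega)
    have o2 := or1 2 (by omega)
    have o3 := or1 3 (by omega)
    have a1 := c3 0 2 (by omega) (by omega) (by omega)
    have a2 := c3 0 3 (by omega) (by omega) (by omega)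
    have a3 := c3 1 3 (by omega) (by omega) (by omega)
    have b1 := c0 0 2 (by omega) (by omega) (by omega)
    have b2 := c0 0 3 (by omega) (by omega) (by omega)
    have b3 := c0 1 3 (by omega) (by omega) (by omega)
    by_cases hc : 2 ≤ d (p 3) (q 0)
    · have A3 := o3.resolve_left (a2 hc)
      exact ⟨q, hq, hc, o1.resolve_right (fun x => b3 x A3), o2.resolve_left (a1 hc), A3⟩
    · have A0 := o0.resolve_left hc
      have A3 := o3.resolve_right (b2 A0)
      exact ⟨_, hq.rev, A3, o2.resolve_right (b1 A0), o1.resolve_left (fun x => a3 x A3), A0⟩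
  have p02 := hp.2 0 2 (by omega) (by omega)
  have p03 := hp.2 0 3 (by omega) (by omega)
  have p12 := hp.2 1 2 (by omega) (by omega)
  have p31 := hp.2 3 1 (by omega) (by omega)
  have p32 := hp.2 3 2 (by omega) (by omega)
  obtain ⟨q0, hq0⟩ := h {p 2, p 0} (by
    intro x hx
    rw [Finset.mem_insert, Finset.mem_singleton] at hx
    rcases hx with rfl | rfl
    · exact P 2 (by omega)
    · exact P 0 (by omega)) (by
    intro e he f hf
    rw [Finset.mem_insert, Finset.mem_singleton] at he hf
    have := dsym (p 2) (p 0)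
    rcases he with rfl | rfl <;> rcases hf with rfl | rfl <;> (try simp only [ds]) <;> omega)
  obtain ⟨q, hq, qa, qb, qc, qe⟩ := struct _ Finset.sdiff_subset q0 hq0
  obtain ⟨r0, hr0⟩ := h {p 3} (by
    intro x hx
    rw [Finset.mem_singleton] at hx; subst hx
    exact P 3 (by omega)) (by
    intro e he f hf
    rw [Finset.mem_singleton] at he hf
    rw [he, hf, ds]; omega)
  obtain ⟨r, hr, ra, rb, rc, re⟩ := struct _ Finset.sdiff_subset r0 hr0
  have q2m := Finset.mem_sdiff.1 (hq.1 2 (by omega))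
  have r3m := Finset.mem_sdiff.1 (hr.1 3 (by omega))
  have r0m := Finset.mem_sdiff.1 (hr.1 0 (by omega))
  have q1m := Finset.mem_sdiff.1 (hq.1 1 (by omega))
  have hq23 : q 2 ≠ p 3 := by
    intro e
    have := hq.2 2 1 (by omega) (by omega)
    rw [e] at this; omega
  have hq22 : q 2 ≠ p 2 := by
    intro e; apply q2m.2; rw [e]; simp
  have hp23 : p 2 ≠ p 3 := by
    intro e; rw [e, ds] at p32; omega
  have hQ3 : ({p 2, p 3, q 2} : Finset α) = S.filter (fun x => 2 ≤ d (p 0) x) := by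
    apply Finset.eq_of_subset_of_card_le
    · intro x hx
      rw [Finset.mem_insert, Finset.mem_insert, Finset.mem_singleton] at hx
      rw [Finset.mem_filter]
      rcases hx with rfl | rfl | rfl
      · exact ⟨P 2 (by omega), by omega⟩
      · exact ⟨P 3 (by omega), by omega⟩
      · exact ⟨q2m.1, qc⟩
    · rw [Finset.card_insert_of_notMem, Finset.card_pair hq23.symm]
      · exact hQ
      · rw [Finset.mem_insert, Finset.mem_singleton]
        rintro (e | e)
        · exact hp23 e
        · exact hq22 e.symm
  have hr3 : r 3 ∈ S.filter (fun x => 2 ≤ d (p 0) x) := Finset.mem_filter.2 ⟨r3m.1, re⟩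
  rw [← hQ3, Finset.mem_insert, Finset.mem_insert, Finset.mem_singleton] at hr3
  have r03 := hr.2 0 3 (by omega) (by omega)
  rcases hr3 with e | e | e
  · have a : d (r 0) (p 1) < 2 := by
      by_contra hc
      exact hno _ (P 3 (by omega)) _ r0m.1 _ (P 1 (by omega)) ra (by omega) (by omega)
    have := dt (r 0) (p 1) (p 2)
    rw [e] at r03; omega
  · exact r3m.2 (by rw [e]; simp)
  · have a : d (r 0) (q 1) < 2 := by
      by_contra hc
      exact hno _ (P 3 (by omega)) _ r0m.1 _ q1m.1 ra qb (by omega)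
    have := dt (r 0) (q 1) (q 2)
    have := hq.2 1 2 (by omega) (by omega)
    rw [e] at r03; omega

theorem k4_alt {T : Finset α} (hd : Met d) (hT : Ind d T) {a b : α} (hab : d a b = 2)
    {q : ℕ → α} (hq : TP d 4 Q q) (hm : ∀ j, j < 4 → q j ∈ T ∨ q j = a ∨ q j = b) :
    ∃ q', TP d 4 Q q' ∧ q' 0 ∈ T ∧ q' 2 ∈ T ∧
      ((q' 1 = a ∧ q' 3 = b) ∨ (q' 1 = b ∧ q' 3 = a)) := by
  obtain ⟨d0, ds, dsym, dt⟩ := id hd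
  have hba : d b a = 2 := by rw [dsym]; exact hab
  have h1 : ∀ j, j + 1 < 4 → q j ∈ T → q (j+1) ∉ T := by
    intro j hj x y
    exact hT _ x _ y (by rw [hq.2 j (j+1) (by omega) hj]; omega)
  have h2 : ∀ j, j + 1 < 4 → q j ∉ T → q (j+1) ∈ T := by
    intro j hj x
    by_contra y
    have e := hq.2 j (j+1) (by omega) hj
    have u := (hm j (by omega)).resolve_left x
    have v := (hm (j+1) hj).resolve_left y
    rcases u with u | u <;> rcases v with v | v <;> rw [u, v] at e <;>
      simp only [ds, hab, hba] at e <;> omega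
  have a0 := h1 0 (by omega)
  have a1 := h1 1 (by omega)
  have a2 := h1 2 (by omega)
  have b0 := h2 0 (by omega)
  have b1 := h2 1 (by omega)
  have b2 := h2 2 (by omega)
  simp only [Nat.zero_add, Nat.reduceAdd] at a0 a1 a2 b0 b1 b2
  have fin : ∀ q : ℕ → α, TP d 4 Q q → (∀ j, j < 4 → q j ∈ T ∨ q j = a ∨ q j = b) →
      q 1 ∉ T → q 3 ∉ T → ((q 1 = a ∧ q 3 = b) ∨ (q 1 = b ∧ q 3 = a)) := by
    intro q hq hm x y
    have e := hq.2 1 3 (by omega) (by omega)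
    have u := (hm 1 (by omega)).resolve_left x
    have v := (hm 3 (by omega)).resolve_left y
    rcases u with u | u <;> rcases v with v | v
    · rw [u, v, ds] at e; omega
    · exact Or.inl ⟨u, v⟩
    · exact Or.inr ⟨u, v⟩
    · rw [u, v, ds] at e; omega
  by_cases hc : q 0 ∈ T
  · exact ⟨q, hq, hc, by tauto, fin q hq hm (by tauto) (by tauto)⟩
  · refine ⟨_, hq.rev, ?_, ?_, fin _ hq.rev (fun j hj => hm _ (by omega)) ?_ ?_⟩
    · show q 3 ∈ T; tauto
    · show q 1 ∈ T; tauto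
    · show q 2 ∉ T; tauto
    · show q 0 ∉ T; tauto

theorem k4_caseA (hd : Met d) {S T : Finset α} (hS : S.card ≤ 7)
    (h : ∀ R ⊆ S, Ind d R → ∃ p, TP d 4 (S \ R) p)
    (hTS : T ⊆ S) (hT : Ind d T) (hTc : T.card = 3) : False := by
  obtain ⟨d0, ds, dsym, dt⟩ := id hd
  obtain ⟨p, hp⟩ := h T hTS hT
  have hST : (S \ T).card ≤ 4 := by
    have := Finset.card_sdiff_add_card_eq_card hTS
    omega
  have P := fun i hi => (Finset.mem_sdiff.1 (hp.1 i hi)).1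
  have hcase : ∀ x ∈ S, x ∈ T ∨ x = p 0 ∨ x = p 1 ∨ x = p 2 ∨ x = p 3 := by
    intro x hx
    by_cases hxT : x ∈ T
    · exact Or.inl hxT
    · right
      obtain ⟨i, hi, rfl⟩ := hp.surj hd hST (Finset.mem_sdiff.2 ⟨hx, hxT⟩)
      have : i = 0 ∨ i = 1 ∨ i = 2 ∨ i = 3 := by omega
      rcases this with rfl | rfl | rfl | rfl <;> simp
  have getq : ∀ i j, i < 4 → j < 4 → d (p i) (p j) ≠ 1 →
      ∃ q, TP d 4 (S \ {p i, p j}) q := by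
    intro i j hi hj hij
    apply h
    · intro x hx
      rw [Finset.mem_insert, Finset.mem_singleton] at hx
      rcases hx with rfl | rfl
      · exact P i hi
      · exact P j hj
    · intro e he f hf
      rw [Finset.mem_insert, Finset.mem_singleton] at he hf
      have := dsym (p i) (p j)
      rcases he with rfl | rfl <;> rcases hf with rfl | rfl <;> (try simp only [ds]) <;> omega
  have p01 := hp.2 0 1 (by omega) (by omega)
  have p02 := hp.2 0 2 (by omega) (by omega)
  have p03 := hp.2 0 3 (by omega) (by omega)
  have p12 := hp.2 1 2 (by omega) (by omega)
  have p13 := hp.2 1 3 (by omega) (by omega)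
  have p23 := hp.2 2 3 (by omega) (by omega)
  obtain ⟨q, hq, hq0, hq1, hq2, hq3⟩ : ∃ q, TP d 4 S q ∧ q 0 ∈ T ∧ q 1 = p 1 ∧ q 2 = p 2 ∧
      q 3 ∈ T := by
    obtain ⟨q, hq⟩ := getq 0 3 (by omega) (by omega) (by omega)
    have hm : ∀ j, j < 4 → q j ∈ T ∨ q j = p 1 ∨ q j = p 2 := by
      intro j hj
      have m := Finset.mem_sdiff.1 (hq.1 j hj)
      rw [Finset.mem_insert, Finset.mem_singleton] at m
      have := hcase _ m.1
      tauto
    have hn : ∀ i j, i < 4 → j < 4 → 2 ≤ (i - j) + (j - i) → q i ∉ T → q j ∉ T → False := by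
      intro i j hi hj hij x y
      have e := hq.2 i j hi hj
      have := dsym (p 1) (p 2)
      have u := (hm i hi).resolve_left x
      have v := (hm j hj).resolve_left y
      rcases u with u | u <;> rcases v with v | v <;> rw [u, v] at e <;>
        (try simp only [ds] at e) <;> omega
    have h1 : ∀ j, j + 1 < 4 → q j ∈ T → q (j+1) ∉ T := by
      intro j hj x y
      exact hT _ x _ y (by rw [hq.2 j (j+1) (by omega) hj]; omega)
    have a0 := h1 0 (by omega)
    have a1 := h1 1 (by omega)
    have a2 := h1 2 (by omega)
    have b0 := hn 0 2 (by omega) (by omega) (by omega)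
    have b1 := hn 0 3 (by omega) (by omega) (by omega)
    have b2 := hn 1 3 (by omega) (by omega) (by omega)
    simp only [Nat.zero_add, Nat.reduceAdd] at a0 a1 a2
    have c0 : q 0 ∈ T := by tauto
    have c1 : q 1 ∉ T := by tauto
    have c3 : q 3 ∈ T := by tauto
    have c2 : q 2 ∉ T := by tauto
    have u := (hm 1 (by omega)).resolve_left c1
    have v := (hm 2 (by omega)).resolve_left c2
    have e := hq.2 1 2 (by omega) (by omega)
    rcases u with u | u <;> rcases v with v | v
    · rw [u, v, ds] at e; omega
    · exact ⟨q, hq.mono Finset.sdiff_subset, c0, u, v, c3⟩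
    · exact ⟨_, hq.rev.mono Finset.sdiff_subset, c3, v, u, c0⟩
    · rw [u, v, ds] at e; omega
  obtain ⟨r, hr, r0, r2, hr13⟩ : ∃ r, TP d 4 S r ∧ r 0 ∈ T ∧ r 2 ∈ T ∧
      ((r 1 = p 1 ∧ r 3 = p 3) ∨ (r 1 = p 3 ∧ r 3 = p 1)) := by
    obtain ⟨r, hr⟩ := getq 0 2 (by omega) (by omega) (by omega)
    refine k4_alt hd hT p13 (hr.mono Finset.sdiff_subset) ?_
    intro j hj
    have m := Finset.mem_sdiff.1 (hr.1 j hj)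
    rw [Finset.mem_insert, Finset.mem_singleton] at m
    have := hcase _ m.1
    tauto
  obtain ⟨s, hs, s0, s2, hs13⟩ : ∃ r, TP d 4 S r ∧ r 0 ∈ T ∧ r 2 ∈ T ∧
      ((r 1 = p 0 ∧ r 3 = p 2) ∨ (r 1 = p 2 ∧ r 3 = p 0)) := by
    obtain ⟨r, hr⟩ := getq 1 3 (by omega) (by omega) (by omega)
    refine k4_alt hd hT p02 (hr.mono Finset.sdiff_subset) ?_
    intro j hj
    have m := Finset.mem_sdiff.1 (hr.1 j hj)
    rw [Finset.mem_insert, Finset.mem_singleton] at m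
    have := hcase _ m.1
    tauto
  have q03 := hq.2 0 3 (by omega) (by omega)
  obtain ⟨z, hz⟩ : ∃ z, ∀ t ∈ T, t = q 0 ∨ t = q 3 ∨ t = z := by
    have hne : q 3 ≠ q 0 := by intro e; rw [e, ds] at q03; omega
    have : ((T.erase (q 0)).erase (q 3)).card = 1 := by
      rw [Finset.card_erase_of_mem (Finset.mem_erase.2 ⟨hne, hq3⟩), Finset.card_erase_of_mem hq0]
      omega
    obtain ⟨z, hz⟩ := Finset.card_eq_one.1 this
    refine ⟨z, fun t ht => ?_⟩
    by_cases e1 : t = q 0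
    · exact Or.inl e1
    by_cases e2 : t = q 3
    · exact Or.inr (Or.inl e2)
    · right; right
      have : t ∈ (T.erase (q 0)).erase (q 3) :=
        Finset.mem_erase.2 ⟨e2, Finset.mem_erase.2 ⟨e1, ht⟩⟩
      rw [hz] at this
      exact Finset.mem_singleton.1 this
  have q01 := hq.2 0 1 (by omega) (by omega)
  have q02 := hq.2 0 2 (by omega) (by omega)
  have q31 := hq.2 3 1 (by omega) (by omega)
  have q32 := hq.2 3 2 (by omega) (by omega)
  rw [hq1] at q01 q31
  rw [hq2] at q02 q32
  have q30 := hq.2 3 0 (by omega) (by omega)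
  generalize q 0 = x at *
  generalize q 3 = y at *
  have tri : ∀ u : α, ∀ i j, i < 4 → j < 4 → d u (p j) ≤ d u (p i) + ((i - j) + (j - i)) := by
    intro u i j hi hj
    rw [← hp.2 i j hi hj]; exact dt _ _ _
  have tri2 : ∀ u : α, d (p 0) (p 3) ≤ d u (p 0) + d u (p 3) := by
    intro u; rw [dsym u (p 0)]; exact dt _ _ _
  have x1 := tri x 0 1 (by omega) (by omega)
  have z10 := tri z 0 1 (by omega) (by omega)
  have z01 := tri z 1 0 (by omega) (by omega)
  have z12 := tri z 1 2 (by omega) (by omega)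
  have z21 := tri z 2 1 (by omega) (by omega)
  have z23 := tri z 2 3 (by omega) (by omega)
  have z32 := tri z 3 2 (by omega) (by omega)
  have zz := tri2 z
  have xx := tri2 x
  have yy := tri2 y
  have r01 := hr.2 0 1 (by omega) (by omega)
  have r02 := hr.2 0 2 (by omega) (by omega)
  have r03 := hr.2 0 3 (by omega) (by omega)
  have r21 := hr.2 2 1 (by omega) (by omega)
  have r23 := hr.2 2 3 (by omega) (by omega)
  have s01 := hs.2 0 1 (by omega) (by omega)
  have s02 := hs.2 0 2 (by omega) (by omega)
  have s03 := hs.2 0 3 (by omega) (by omega)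
  have s21 := hs.2 2 1 (by omega) (by omega)
  have s23 := hs.2 2 3 (by omega) (by omega)
  have hr0 := hz _ r0
  have hr2 := hz _ r2
  have hs0 := hz _ s0
  have hs2 := hz _ s2
  have dxx := ds x
  have dyy := ds y
  have dzz := ds z
  clear hr hs hp hq hz h hcase getq tri tri2 P r0 r2 s0 s2
  rcases hr0 with e0 | e0 | e0 <;> rcases hr2 with e2 | e2 | e2 <;> rw [e0, e2] at r02 <;>
    try (exfalso; omega)
  all_goals
    rcases hr13 with ⟨e1, e3⟩ | ⟨e1, e3⟩ <;> rw [e0, e1] at r01 <;> rw [e0, e3] at r03 <;>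
      rw [e2, e1] at r21 <;> rw [e2, e3] at r23 <;> try (exfalso; omega)
  all_goals
    rcases hs0 with f0 | f0 | f0 <;> rcases hs2 with f2 | f2 | f2 <;> rw [f0, f2] at s02 <;>
      try (exfalso; omega)
  all_goals
    rcases hs13 with ⟨f1, f3⟩ | ⟨f1, f3⟩ <;> rw [f0, f1] at s01 <;> rw [f0, f3] at s03 <;>
      rw [f2, f1] at s21 <;> rw [f2, f3] at s23 <;> (exfalso; omega)

theorem core_four (hd : Met d) {S : Finset α} (hS : S.card ≤ 7)
    (h : ∀ R ⊆ S, Ind d R → ∃ p, TP d 4 (S \ R) p) : False := by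
  obtain ⟨d0, ds, dsym, dt⟩ := id hd
  have hno : ∀ x ∈ S, ∀ y ∈ S, ∀ z ∈ S, 2 ≤ d x y → 2 ≤ d x z → 2 ≤ d y z → False := by
    intro x hx y hy z hz hxy hxz hyz
    have n1 : x ≠ y := by rintro rfl; rw [ds] at hxy; omega
    have n2 : x ≠ z := by rintro rfl; rw [ds] at hxz; omega
    have n3 : y ≠ z := by rintro rfl; rw [ds] at hyz; omega
    apply k4_caseA hd hS h (T := {x, y, z})
    · intro t ht
      simp only [Finset.mem_insert, Finset.mem_singleton] at ht
      rcases ht with rfl | rfl | rfl <;> assumption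
    · intro e he f hf
      simp only [Finset.mem_insert, Finset.mem_singleton] at he hf
      have := dsym x y
      have := dsym x z
      have := dsym y z
      have := ds x
      have := ds y
      have := ds z
      rcases he with rfl | rfl | rfl <;> rcases hf with rfl | rfl | rfl <;> omega
    · rw [Finset.card_insert_of_notMem, Finset.card_pair n3]
      simp [n1, n2]
  obtain ⟨p, hp⟩ := h ∅ (by simp) (by simp [Ind])
  rw [Finset.sdiff_empty] at hp
  by_cases hc : (S.filter (fun x => 2 ≤ d (p 0) x)).card ≤ 3
  · exact k4_caseB hd h hno hp hc
  · refine k4_caseB hd h hno hp.rev ?_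
    show (S.filter (fun x => 2 ≤ d (p 3) x)).card ≤ 3
    have hdis : Disjoint (S.filter (fun x => 2 ≤ d (p 0) x)) (S.filter (fun x => 2 ≤ d (p 3) x)) := by
      rw [Finset.disjoint_left]
      intro x hx hy
      rw [Finset.mem_filter] at hx hy
      refine hno _ (hp.1 0 (by omega)) _ (hp.1 3 (by omega)) x hx.1 ?_ hx.2 hy.2
      rw [hp.2 0 3 (by omega) (by omega)]; omega
    have h1 := Finset.card_union_of_disjoint hdis
    have h2 := Finset.card_le_card (Finset.union_subset
      (Finset.filter_subset (fun x => 2 ≤ d (p 0) x) S)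
      (Finset.filter_subset (fun x => 2 ≤ d (p 3) x) S))
    omega

theorem core (hd : Met d) {S : Finset α} (hk : 4 ≤ k)
    (hS : S.card ≤ if k = 4 then 7 else k + (k+1)/2) :
    ∃ R ⊆ S, Ind d R ∧ ∀ p, ¬ TP d k (S \ R) p := by
  by_contra hcon
  push Not at hcon
  split_ifs at hS with h4
  · subst h4; exact core_four hd hS hcon
  · by_cases hp : k % 2 = 0
    · exact core_even hd hk hp hS hcon
    · exact core_odd hd (by omega) (by omega) hS hcon
end

theorem mem_vset {G : Finset (Finset ℕ)} {x : ℕ} : x ∈ vset G ↔ ∃ e ∈ G, x ∈ e := by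
  simp [vset, Finset.mem_sup]

theorem sub_vset {G : Finset (Finset ℕ)} {e : Finset ℕ} (he : e ∈ G) : e ⊆ vset G :=
  fun _ hx => mem_vset.2 ⟨e, he, hx⟩

/-! ### density bounds -/

theorem cyc_step {t : ℕ} (ht : 0 < t) (B : Finset ℕ) (hB : B ⊆ Finset.range t) (hne : B.Nonempty)
    (hlt : B.card < t) : B.card + 1 ≤ (B ∪ B.image (fun x => (x + 1) % t)).card := by
  by_contra hcon
  have h1 : B = B ∪ B.image (fun x => (x + 1) % t) :=
    Finset.eq_of_subset_of_card_le Finset.subset_union_left (by omega)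
  have h2 : ∀ x ∈ B, (x + 1) % t ∈ B := by
    intro x hx
    rw [h1]
    exact Finset.mem_union_right _ (Finset.mem_image_of_mem (fun x => (x + 1) % t) hx)
  obtain ⟨b, hb⟩ := hne
  have hbt := Finset.mem_range.1 (hB hb)
  have h3 : ∀ n, (b + n) % t ∈ B := by
    intro n
    induction n with
    | zero => rw [add_zero, Nat.mod_eq_of_lt hbt]; exact hb
    | succ n ih =>
      have := h2 _ ih
      rwa [Nat.mod_add_mod, add_assoc] at this
  have h4 : Finset.range t ⊆ B := by
    intro x hx
    rw [Finset.mem_range] at hx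
    have := h3 (t - b + x)
    rwa [show b + (t - b + x) = x + t by omega, Nat.add_mod_right, Nat.mod_eq_of_lt hx] at this
  have := Finset.card_le_card h4
  rw [Finset.card_range] at this
  omega

theorem cyc_cover {t : ℕ} (ht : 0 < t) (A : Finset ℕ) (hA : A ⊆ Finset.range t) (hne : A.Nonempty)
    (j : ℕ) : min t (A.card + j) ≤ (A.biUnion (cycEdge (j+1) t)).card := by
  have hsub : ∀ j, A.biUnion (cycEdge j t) ⊆ Finset.range t := by
    intro j x hx
    simp only [Finset.mem_biUnion, cycEdge, Finset.mem_image] at hx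
    obtain ⟨_, _, _, _, rfl⟩ := hx
    exact Finset.mem_range.2 (Nat.mod_lt _ ht)
  have hA1 : A ⊆ A.biUnion (cycEdge 1 t) := by
    intro x hx
    simp only [Finset.mem_biUnion, cycEdge, Finset.mem_image]
    exact ⟨x, hx, 0, by simp, by simp [Nat.mod_eq_of_lt (Finset.mem_range.1 (hA hx))]⟩
  induction j with
  | zero => exact (min_le_right _ _).trans (Finset.card_le_card hA1)
  | succ j ih =>
    have hs : A.biUnion (cycEdge (j+1) t) ∪
        (A.biUnion (cycEdge (j+1) t)).image (fun x => (x + 1) % t) ⊆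
        A.biUnion (cycEdge (j+2) t) := by
      intro x hx
      rcases Finset.mem_union.1 hx with hx | hx
      · simp only [Finset.mem_biUnion, cycEdge, Finset.mem_image, Finset.mem_range] at hx ⊢
        obtain ⟨i, hi, s, hs, rfl⟩ := hx
        exact ⟨i, hi, s, by omega, rfl⟩
      · simp only [Finset.mem_biUnion, cycEdge, Finset.mem_image, Finset.mem_range] at hx ⊢
        obtain ⟨_, ⟨i, hi, s, hs, rfl⟩, rfl⟩ := hx
        exact ⟨i, hi, s + 1, by omega, by rw [Nat.mod_add_mod, add_assoc]⟩
    have hc := Finset.card_le_card hs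
    by_cases hlt : (A.biUnion (cycEdge (j+1) t)).card < t
    · have hn : (A.biUnion (cycEdge (j+1) t)).Nonempty := by
        rw [← Finset.card_pos]
        have := hne.card_pos
        omega
      have := cyc_step ht _ (hsub (j+1)) hn hlt
      show _ ≤ (A.biUnion (cycEdge (j+2) t)).card
      omega
    · have := Finset.card_le_card (Finset.subset_union_left.trans hs)
      show _ ≤ (A.biUnion (cycEdge (j+2) t)).card
      omega

theorem cyc_vcount {k t : ℕ} (hk : 0 < k) (ht : 0 < t) (H : Finset (Finset ℕ))
    (hH : H ⊆ tightCycle k t) (hne : H.Nonempty) :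
    min t (H.card + (k-1)) ≤ vcount H ∧ H.card ≤ t := by
  set A := (Finset.range t).filter (fun i => cycEdge k t i ∈ H) with hA
  have h1 : H ⊆ A.image (cycEdge k t) := by
    intro e he
    obtain ⟨i, hi, rfl⟩ := Finset.mem_image.1 (hH he)
    exact Finset.mem_image.2 ⟨i, Finset.mem_filter.2 ⟨hi, he⟩, rfl⟩
  have h2 : H.card ≤ A.card := (Finset.card_le_card h1).trans Finset.card_image_le
  have hAr : A ⊆ Finset.range t := Finset.filter_subset _ _
  have h3 : A.card ≤ t := by simpa using Finset.card_le_card hAr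
  have hAn : A.Nonempty := by rw [← Finset.card_pos]; have := hne.card_pos; omega
  have h4 := cyc_cover ht A hAr hAn (k-1)
  rw [Nat.sub_add_cancel hk] at h4
  have h5 : A.biUnion (cycEdge k t) ⊆ vset H := by
    intro x hx
    obtain ⟨i, hi, hx⟩ := Finset.mem_biUnion.1 hx
    exact mem_vset.2 ⟨_, (Finset.mem_filter.1 hi).2, hx⟩
  have h6 := Finset.card_le_card h5
  refine ⟨?_, by omega⟩
  unfold vcount
  omega

theorem dk_cyc_le {k t : ℕ} (hk : 4 ≤ k) (ht : 2 * k - 1 ≤ t) (H : Finset (Finset ℕ))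
    (hH : H ⊆ tightCycle k t) : dk k H ≤ ((t : ℝ) - 1) / ((t : ℝ) - k) := by
  have htk : (k : ℝ) + 1 ≤ t := by exact_mod_cast (by omega : k + 1 ≤ t)
  have hk' : (4 : ℝ) ≤ k := by exact_mod_cast hk
  have hM1 : 1 ≤ ((t : ℝ) - 1) / ((t : ℝ) - k) := by
    rw [le_div_iff₀ (by linarith)]; linarith
  unfold dk
  split_ifs with h0 h1
  · linarith
  · refine le_trans ?_ hM1
    rw [div_le_one (by linarith)]; linarith
  · have hne : H.Nonempty := Finset.card_pos.1 (by omega)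
    obtain ⟨h2, h3⟩ := cyc_vcount (by omega) (by omega) H hH hne
    have h3' : (H.card : ℝ) ≤ t := by exact_mod_cast h3
    by_cases he : H.card = 1
    · rw [he]; simp; linarith
    · have he' : (2 : ℝ) ≤ H.card := by exact_mod_cast (by omega : 2 ≤ H.card)
      have hv : (k : ℝ) + 1 ≤ vcount H := by exact_mod_cast (by omega : k + 1 ≤ vcount H)
      rw [div_le_div_iff₀ (by linarith) (by linarith)]
      have : t ≤ vcount H ∨ H.card + (k - 1) ≤ vcount H := by omega
      rcases this with h | h
      · have h' : (t : ℝ) ≤ vcount H := by exact_mod_cast h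
        apply mul_le_mul <;> linarith
      · have h' : (H.card : ℝ) + k ≤ vcount H + 1 := by
          exact_mod_cast (by omega : H.card + k ≤ vcount H + 1)
        rw [mul_comm]
        apply mul_le_mul <;> linarith

theorem cycEdge_card {k t i : ℕ} (h : k ≤ t) : (cycEdge k t i).card = k := by
  unfold cycEdge
  rw [Finset.card_image_of_injOn, Finset.card_range]
  intro a ha b hb e
  simp only [Finset.coe_range, Set.mem_Iio] at ha hb
  have : a ≡ b [MOD t] := Nat.ModEq.add_left_cancel' i e
  exact Nat.ModEq.eq_of_lt_of_lt this (by omega) (by omega)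

theorem mk_cyc {k t : ℕ} (hk : 4 ≤ k) (ht : 2 * k - 1 ≤ t) :
    0 < mk k (tightCycle k t) ∧ mk k (tightCycle k t) ≤ ((t : ℝ) - 1) / ((t : ℝ) - k) := by
  have hb : ∀ x ∈ {x : ℝ | ∃ H ⊆ tightCycle k t, x = dk k H},
      x ≤ ((t : ℝ) - 1) / ((t : ℝ) - k) := by
    rintro x ⟨H, hH, rfl⟩
    exact dk_cyc_le hk ht H hH
  constructor
  · have : dk k {cycEdge k t 0} ≤ mk k (tightCycle k t) := by
      apply le_csSup ⟨_, hb⟩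
      refine ⟨{cycEdge k t 0}, ?_, rfl⟩
      rw [Finset.singleton_subset_iff]
      exact Finset.mem_image.2 ⟨0, Finset.mem_range.2 (by omega), rfl⟩
    refine lt_of_lt_of_le ?_ this
    have hv : vcount {cycEdge k t 0} = k := by
      simp [vcount, vset, cycEdge_card (show k ≤ t by omega)]
    unfold dk
    rw [if_neg (by simp), if_pos ⟨by simp, hv⟩]
    have : (4 : ℝ) ≤ k := by exact_mod_cast hk
    positivity
  · exact csSup_le ⟨_, ∅, by simp, rfl⟩ hb

/-! ### The graph `K₃⁺` -/

def cen (k : ℕ) : Finset ℕ := (Finset.range (k + 1)).filter (fun x => 3 ≤ x)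

theorem cen_card {k : ℕ} (hk : 4 ≤ k) : (cen k).card = k - 2 := by
  have : cen k = Finset.Ico 3 (k+1) := by
    ext x; simp [cen]; omega
  rw [this, Nat.card_Ico]; omega

theorem mem_K3 {k : ℕ} {e : Finset ℕ} : e ∈ K3plus k ↔
    e = {0, 1} ∪ cen k ∨ e = {0, 2} ∪ cen k ∨ e = {1, 2} ∪ cen k := by
  simp [K3plus, cen]

theorem not_cen {k a : ℕ} (h : a < 3) : a ∉ cen k := by
  simp [cen]; omega

theorem K3_edge_card {k : ℕ} (hk : 4 ≤ k) {e : Finset ℕ} (he : e ∈ K3plus k) : e.card = k := by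
  have key : ∀ a b, a < 3 → b < 3 → a ≠ b → (({a, b} : Finset ℕ) ∪ cen k).card = k := by
    intro a b ha hb hab
    rw [Finset.card_union_of_disjoint, Finset.card_pair hab, cen_card hk]
    · omega
    · rw [Finset.disjoint_left]
      intro x hx
      simp only [Finset.mem_insert, Finset.mem_singleton] at hx
      rcases hx with rfl | rfl
      · exact not_cen ha
      · exact not_cen hb
  rcases mem_K3.1 he with rfl | rfl | rfl <;> apply key <;> omega

theorem mkA_le {k t : ℕ} (hk : 4 ≤ k) (ht : 2 * k - 1 ≤ t) :
    mkA k (K3plus k) (tightCycle k t) ≤ 3 * ((t : ℝ) - 1) / (2 * t - k - 1) := by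
  obtain ⟨m0, m1⟩ := mk_cyc hk ht
  have htk : (2 * k : ℝ) ≤ t + 1 := by exact_mod_cast (by omega : 2 * k ≤ t + 1)
  have hk' : (4 : ℝ) ≤ k := by exact_mod_cast hk
  set M := mk k (tightCycle k t)
  have hx : ((t : ℝ) - k) / (t - 1) ≤ 1 / M := by
    rw [div_le_div_iff₀ (by linarith) m0]
    rw [le_div_iff₀ (by linarith)] at m1
    linarith
  have hx0 : 0 < ((t : ℝ) - k) / (t - 1) := div_pos (by linarith) (by linarith)
  have hy : ((t : ℝ) - k) / (t - 1) * (t - 1) = t - k :=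
    div_mul_cancel₀ _ (by linarith)
  set y := ((t : ℝ) - k) / (t - 1) with hyd
  have hB : 0 < 3 * ((t : ℝ) - 1) / (2 * t - k - 1) := div_pos (by linarith) (by linarith)
  apply Real.sSup_le _ hB.le
  rintro z ⟨H, hH, hne, rfl⟩
  have hc3 : H.card ≤ 3 := (Finset.card_le_card hH).trans Finset.card_le_three
  obtain ⟨e, he⟩ := id hne
  have hec := K3_edge_card hk (hH he)
  have hv1 : k ≤ vcount H := by
    rw [← hec]; exact Finset.card_le_card (sub_vset he)
  by_cases h1 : H.card = 1
  · have hv' : (k : ℝ) ≤ vcount H := by exact_mod_cast hv1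
    rw [h1, div_le_div_iff₀ (by linarith) (by linarith)]
    have : y ≤ (vcount H : ℝ) - k + 1 / M := by linarith
    have := mul_le_mul_of_nonneg_left this (show 0 ≤ 3 * ((t : ℝ) - 1) by linarith)
    push_cast
    nlinarith
  · have hv2 : k + 1 ≤ vcount H := by
      by_contra hcon
      have heq : ∀ f ∈ H, f = vset H := by
        intro f hf
        apply Finset.eq_of_subset_of_card_le (sub_vset hf)
        rw [K3_edge_card hk (hH hf)]
        unfold vcount at hcon; omega
      have : H.card ≤ 1 := Finset.card_le_one.2 (fun a ha b hb => (heq a ha).trans (heq b hb).symm)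
      have := hne.card_pos
      omega
    have hv' : (k : ℝ) + 1 ≤ vcount H := by exact_mod_cast hv2
    have hc' : (H.card : ℝ) ≤ 3 := by exact_mod_cast hc3
    rw [div_le_div_iff₀ (by linarith) (by linarith)]
    have h2 : 1 + y ≤ (vcount H : ℝ) - k + 1 / M := by linarith
    have h3 := mul_le_mul_of_nonneg_left h2 (show 0 ≤ 3 * ((t : ℝ) - 1) by linarith)
    have h4 := mul_le_mul_of_nonneg_right hc' (show 0 ≤ 2 * (t : ℝ) - k - 1 by linarith)
    nlinarith

def DD (k : ℕ) : ℕ := if k = 4 then 7 else k + (k+1)/2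

theorem tk_ge {k : ℕ} (hk : 4 ≤ k) : 2 * k - 1 ≤ tk k := by
  unfold tk
  split_ifs
  · omega
  · omega
  · have : 2 * k ≤ k ^ 2 := by nlinarith
    omega

theorem numeric {k : ℕ} (hk : 4 ≤ k) :
    (k : ℝ) * (3 * ((tk k : ℝ) - 1) / (2 * (tk k : ℝ) - k - 1)) < (DD k : ℝ) + 1 := by
  by_cases h4 : k = 4
  · subst h4; norm_num [tk, DD]
  by_cases h5 : k = 5
  · subst h5; norm_num [tk, DD]
  have hk' : (6 : ℝ) ≤ k := by exact_mod_cast (by omega : 6 ≤ k)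
  have hD : (3 * k : ℝ) ≤ 2 * DD k := by
    have : 3 * k ≤ 2 * DD k := by unfold DD; rw [if_neg h4]; omega
    exact_mod_cast this
  have ht : (tk k : ℝ) = (k : ℝ) ^ 2 := by
    unfold tk; rw [if_neg h4, if_neg h5]; push_cast; rfl
  rw [ht]
  have hpos : 0 < 2 * (k : ℝ) ^ 2 - k - 1 := by nlinarith
  rw [mul_div_assoc', div_lt_iff₀ hpos]
  have h1 : (3 * (k : ℝ) / 2 + 1) * (2 * (k : ℝ) ^ 2 - k - 1) ≤
      ((DD k : ℝ) + 1) * (2 * (k : ℝ) ^ 2 - k - 1) :=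
    mul_le_mul_of_nonneg_right (by linarith) hpos.le
  refine lt_of_lt_of_le ?_ h1
  nlinarith [mul_pos (show (0:ℝ) < k - 1 by linarith) (show (0:ℝ) < k + 2 by linarith)]

theorem exists_low {k : ℕ} (hk : 4 ≤ k) {H G : Finset (Finset ℕ)} (hu : IsUniform k H)
    (hm : mDens H ≤ mkA k (K3plus k) (tightCycle k (tk k))) (hG : G ⊆ H) (hne : G.Nonempty) :
    ∃ v ∈ vset G, (G.filter (fun e => v ∈ e)).card ≤ DD k := by
  by_contra hcon
  push Not at hcon
  have hv : 1 ≤ vcount G := by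
    obtain ⟨e, he⟩ := hne
    have := Finset.card_le_card (sub_vset he)
    rw [hu e (hG he)] at this
    unfold vcount; omega
  have hfin : Set.Finite {x : ℝ | ∃ H' ⊆ H, 1 ≤ vcount H' ∧
      x = (H'.card : ℝ) / (vcount H' : ℝ)} := by
    apply Set.Finite.subset ((H.powerset.finite_toSet).image
      (fun H' => (H'.card : ℝ) / (vcount H' : ℝ)))
    rintro x ⟨H', h1, _, rfl⟩
    exact ⟨H', by simpa using h1, rfl⟩
  have h1 : (G.card : ℝ) / (vcount G : ℝ) ≤ mDens H :=
    le_csSup hfin.bddAbove ⟨G, hG, hv, rfl⟩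
  have h2 := (h1.trans hm).trans (mkA_le hk (tk_ge hk))
  have hv' : (0 : ℝ) < vcount G := by exact_mod_cast hv
  have h3 := numeric hk
  have hk' : (4 : ℝ) ≤ k := by exact_mod_cast hk
  have h4 := mul_le_mul_of_nonneg_left h2 (show (0 : ℝ) ≤ k by linarith)
  have h5 := lt_of_le_of_lt h4 h3
  rw [mul_div_assoc', div_lt_iff₀ hv'] at h5
  have h6 : ∑ v ∈ vset G, (G.filter (fun e => v ∈ e)).card = G.card * k := by
    simp only [Finset.card_filter]
    rw [Finset.sum_comm]
    rw [← smul_eq_mul, ← Finset.sum_const]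
    apply Finset.sum_congr rfl
    intro e he
    rw [← Finset.card_filter, ← hu e (hG he)]
    congr 1
    ext x
    simp only [Finset.mem_filter]
    exact ⟨fun h => h.2, fun h => ⟨sub_vset he h, h⟩⟩
  have h7 : (vset G).card * (DD k + 1) ≤ G.card * k := by
    rw [← h6, ← smul_eq_mul, ← Finset.sum_const]
    apply Finset.sum_le_sum
    intro v hv
    exact hcon v hv
  have h8 : (vcount G : ℝ) * ((DD k : ℝ) + 1) ≤ G.card * k := by exact_mod_cast h7
  linarith

/-! ### the metric on edges -/

def dd (e f : Finset ℕ) : ℕ := max (e \ f).card (f \ e).card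

theorem dd_met : Met dd := by
  refine ⟨?_, ?_, ?_, ?_⟩
  · intro x y h
    unfold dd at h
    have h1 : (x \ y).card = 0 := by omega
    have h2 : (y \ x).card = 0 := by omega
    rw [Finset.card_eq_zero, Finset.sdiff_eq_empty_iff_subset] at h1 h2
    exact Finset.Subset.antisymm h1 h2
  · intro x; simp [dd]
  · intro x y; exact max_comm _ _
  · intro x y z
    have key : ∀ x y z : Finset ℕ, (x \ z).card ≤ (x \ y).card + (y \ z).card := by
      intro x y z
      refine le_trans (Finset.card_le_card ?_) (Finset.card_union_le _ _)
      intro a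
      simp only [Finset.mem_union, Finset.mem_sdiff]
      tauto
    have := key x y z
    have := key z y x
    unfold dd
    omega

theorem image_sdiff_card {f : ℕ → ℕ} {W A B : Finset ℕ} (hf : Set.InjOn f ↑W) (hA : A ⊆ W)
    (hB : B ⊆ W) : (A.image f \ B.image f).card = (A \ B).card := by
  have : A.image f \ B.image f = (A \ B).image f := by
    ext x
    simp only [Finset.mem_sdiff, Finset.mem_image]
    constructor
    · rintro ⟨⟨a, ha, rfl⟩, h⟩
      exact ⟨a, ⟨ha, fun hb => h ⟨a, hb, rfl⟩⟩, rfl⟩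
    · rintro ⟨a, ⟨ha, hb⟩, rfl⟩
      refine ⟨⟨a, ha, rfl⟩, ?_⟩
      rintro ⟨b, hb', e⟩
      have := hf (hB hb') (hA ha) e
      exact hb (this ▸ hb')
  rw [this, Finset.card_image_of_injOn]
  intro a ha b hb e
  exact hf (hA (Finset.mem_sdiff.1 ha).1) (hA (Finset.mem_sdiff.1 hb).1) e

theorem K3_dd {k a b c : ℕ} (ha : a < 3) (hb : b < 3) (hc : c < 3) (hab : a ≠ b)
    (hac : a ≠ c) (hbc : b ≠ c) :
    ((({a, b} : Finset ℕ) ∪ cen k) \ (({a, c} : Finset ℕ) ∪ cen k)).card = 1 := by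
  have : ((({a, b} : Finset ℕ) ∪ cen k) \ (({a, c} : Finset ℕ) ∪ cen k)) = {b} := by
    ext x
    have hb' := not_cen (k := k) hb
    simp only [Finset.mem_sdiff, Finset.mem_union, Finset.mem_insert, Finset.mem_singleton]
    constructor
    · tauto
    · rintro rfl
      exact ⟨Or.inl (Or.inr rfl), by tauto⟩
  rw [this, Finset.card_singleton]

theorem K3_mem_cases {k u : ℕ} {e : Finset ℕ} (he : e ∈ K3plus k) (hu : u ∈ e) :
    u = 0 ∨ u = 1 ∨ u = 2 ∨ u ∈ cen k := by
  rcases mem_K3.1 he with h | h | h <;> rw [h] at hu <;>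
    simp only [Finset.mem_union, Finset.mem_insert, Finset.mem_singleton] at hu <;> clear h he <;>
    rcases hu with (hu | hu) | hu <;> simp only [hu, true_or, or_true]

theorem K3_pair {k : ℕ} {F' : Finset (Finset ℕ)} (hF : IsCopy (K3plus k) F')
    {v : ℕ} {e : Finset ℕ} (he : e ∈ F') (hv : v ∈ e) :
    ∃ x ∈ F', ∃ y ∈ F', v ∈ x ∧ v ∈ y ∧ dd x y = 1 := by
  obtain ⟨f, hf, rfl⟩ := hF
  have m01 : ({0, 1} : Finset ℕ) ∪ cen k ∈ K3plus k := mem_K3.2 (by simp)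
  have m02 : ({0, 2} : Finset ℕ) ∪ cen k ∈ K3plus k := mem_K3.2 (by simp)
  have m12 : ({1, 2} : Finset ℕ) ∪ cen k ∈ K3plus k := mem_K3.2 (by simp)
  obtain ⟨e', he', rfl⟩ := Finset.mem_image.1 he
  obtain ⟨u, hu, rfl⟩ := Finset.mem_image.1 hv
  have hfin : ∀ a b c, a < 3 → b < 3 → c < 3 → a ≠ b → a ≠ c → b ≠ c →
      ({a, b} : Finset ℕ) ∪ cen k ∈ K3plus k → ({a, c} : Finset ℕ) ∪ cen k ∈ K3plus k →
      (u = a ∨ u ∈ cen k) →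
      ∃ x ∈ (K3plus k).image (Finset.image f), ∃ y ∈ (K3plus k).image (Finset.image f),
        f u ∈ x ∧ f u ∈ y ∧ dd x y = 1 := by
    intro a b c ha hb hc hab hac hbc h1 h2 hu
    refine ⟨_, Finset.mem_image_of_mem _ h1, _, Finset.mem_image_of_mem _ h2,
      Finset.mem_image_of_mem _ ?_, Finset.mem_image_of_mem _ ?_, ?_⟩
    · rcases hu with rfl | hu
      · simp
      · exact Finset.mem_union_right _ hu
    · rcases hu with rfl | hu
      · simp
      · exact Finset.mem_union_right _ hu
    · unfold dd
      rw [image_sdiff_card hf (sub_vset h1) (sub_vset h2),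
        image_sdiff_card hf (sub_vset h2) (sub_vset h1),
        K3_dd ha hb hc hab hac hbc, K3_dd ha hc hb hac hab hbc.symm]
      rfl
  have m10 : ({1, 0} : Finset ℕ) ∪ cen k ∈ K3plus k := by rw [Finset.pair_comm]; exact m01
  have m20 : ({2, 0} : Finset ℕ) ∪ cen k ∈ K3plus k := by rw [Finset.pair_comm]; exact m02
  have m21 : ({2, 1} : Finset ℕ) ∪ cen k ∈ K3plus k := by rw [Finset.pair_comm]; exact m12
  have hu' : u = 0 ∨ u = 1 ∨ u = 2 ∨ u ∈ cen k := by
    exact K3_mem_cases he' hu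
  rcases hu' with h | h | h | h
  · exact hfin 0 1 2 (by omega) (by omega) (by omega) (by omega) (by omega) (by omega) m01 m02
      (Or.inl h)
  · exact hfin 1 0 2 (by omega) (by omega) (by omega) (by omega) (by omega) (by omega) m10 m12
      (Or.inl h)
  · exact hfin 2 0 1 (by omega) (by omega) (by omega) (by omega) (by omega) (by omega) m20 m21
      (Or.inl h)
  · exact hfin 0 1 2 (by omega) (by omega) (by omega) (by omega) (by omega) (by omega) m01 m02
      (Or.inr h)

theorem Ico_sdiff_card {k s r : ℕ} (hs : s < k) (hr : r < k) :
    (Finset.Ico s (s+k) \ Finset.Ico r (r+k)).card = (s - r) + (r - s) := by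
  rcases le_total s r with h | h
  · have : Finset.Ico s (s+k) \ Finset.Ico r (r+k) = Finset.Ico s r := by
      ext x; simp only [Finset.mem_sdiff, Finset.mem_Ico]; omega
    rw [this, Nat.card_Ico]; omega
  · have : Finset.Ico s (s+k) \ Finset.Ico r (r+k) = Finset.Ico (r+k) (s+k) := by
      ext x; simp only [Finset.mem_sdiff, Finset.mem_Ico]; omega
    rw [this, Nat.card_Ico]; omega

theorem cyc_path {k t : ℕ} (hk : 4 ≤ k) (ht : 2 * k - 1 ≤ t) {F' : Finset (Finset ℕ)}
    (hF : IsCopy (tightCycle k t) F') {v : ℕ} {e : Finset ℕ} (he : e ∈ F') (hv : v ∈ e) :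
    ∃ p, TP dd k (F'.filter (fun e => v ∈ e)) p := by
  obtain ⟨f, hf, rfl⟩ := hF
  obtain ⟨e', he', rfl⟩ := Finset.mem_image.1 he
  obtain ⟨u, hu, rfl⟩ := Finset.mem_image.1 hv
  obtain ⟨i, hi, rfl⟩ := Finset.mem_image.1 he'
  obtain ⟨j, hj, rfl⟩ := Finset.mem_image.1 hu
  have hmem : ∀ n, cycEdge k t n ∈ tightCycle k t := by
    intro n
    refine Finset.mem_image.2 ⟨n % t, Finset.mem_range.2 (Nat.mod_lt _ (by omega)), ?_⟩
    unfold cycEdge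
    apply Finset.image_congr
    intro x _
    simp
  have hvs : ∀ n, n % t ∈ vset (tightCycle k t) := by
    intro n
    exact mem_vset.2 ⟨_, hmem n, Finset.mem_image.2 ⟨0, Finset.mem_range.2 (by omega), by simp⟩⟩
  set a := i + j + t - (k - 1) with ha
  set g : ℕ → ℕ := fun n => f ((a + n) % t) with hg
  have hginj : Set.InjOn g ↑(Finset.range (2 * k - 1)) := by
    intro x hx y hy e
    simp only [Finset.coe_range, Set.mem_Iio] at hx hy
    have := hf (hvs _) (hvs _) e
    have : x ≡ y [MOD t] := Nat.ModEq.add_left_cancel' a this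
    exact Nat.ModEq.eq_of_lt_of_lt this (by omega) (by omega)
  have hpe : ∀ s, (cycEdge k t (a + s)).image f = (Finset.Ico s (s + k)).image g := by
    intro s
    ext x
    simp only [cycEdge, Finset.mem_image, Finset.mem_range, Finset.mem_Ico, hg]
    constructor
    · rintro ⟨_, ⟨b, hb, rfl⟩, rfl⟩
      exact ⟨s + b, by omega, by rw [add_assoc]⟩
    · rintro ⟨b, hb, rfl⟩
      exact ⟨_, ⟨b - s, by omega, rfl⟩, by congr 2; omega⟩
  refine ⟨fun s => (cycEdge k t (a + s)).image f, ?_, ?_⟩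
  · intro s hs
    rw [Finset.mem_filter]
    refine ⟨Finset.mem_image_of_mem _ (hmem _), Finset.mem_image_of_mem _ ?_⟩
    refine Finset.mem_image.2 ⟨k - 1 - s, Finset.mem_range.2 (by omega), ?_⟩
    show (a + s + (k - 1 - s)) % t = (i + j) % t
    rw [show a + s + (k - 1 - s) = i + j + t by omega, Nat.add_mod_right]
  · intro s r hs hr
    have hsub : ∀ s, s < k → Finset.Ico s (s + k) ⊆ Finset.range (2 * k - 1) := by
      intro s hs x hx
      rw [Finset.mem_Ico] at hx
      rw [Finset.mem_range]; omega
    show dd ((cycEdge k t (a + s)).image f) ((cycEdge k t (a + r)).image f) = _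
    rw [hpe s, hpe r]
    unfold dd
    rw [image_sdiff_card hginj (hsub s hs) (hsub r hr),
      image_sdiff_card hginj (hsub r hr) (hsub s hs), Ico_sdiff_card hs hr, Ico_sdiff_card hr hs]
    omega

theorem K3_copy_ne {k : ℕ} {F' : Finset (Finset ℕ)} (hF : IsCopy (K3plus k) F') : F'.Nonempty := by
  obtain ⟨f, _, rfl⟩ := hF
  exact ⟨_, Finset.mem_image_of_mem _ (mem_K3.2 (Or.inl rfl))⟩

theorem cyc_copy_ne {k t : ℕ} (ht : 0 < t) {F' : Finset (Finset ℕ)}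
    (hF : IsCopy (tightCycle k t) F') : F'.Nonempty := by
  obtain ⟨f, _, rfl⟩ := hF
  exact ⟨_, Finset.mem_image_of_mem _ (Finset.mem_image_of_mem _ (Finset.mem_range.2 ht))⟩

theorem core_nosd {α : Type} {d : α → α → ℕ} {k : ℕ} (hd : Met d) {S : Finset α} (hk : 4 ≤ k)
    (hS : S.card ≤ if k = 4 then 7 else k + (k+1)/2) :
    ∃ R ⊆ S, Ind d R ∧ ∀ p Q, (∀ x ∈ Q, x ∈ S ∧ x ∉ R) → ¬ TP d k Q p := by
  obtain ⟨R, h1, h2, h3⟩ := core hd hk hS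
  refine ⟨R, h1, h2, fun p Q hQ hp => h3 p ⟨fun i hi => ?_, hp.2⟩⟩
  simpa using hQ _ (hp.1 i hi)

theorem main_aux {k : ℕ} (hk : 4 ≤ k) {H : Finset (Finset ℕ)} (hu : IsUniform k H)
    (hm : mDens H ≤ mkA k (K3plus k) (tightCycle k (tk k))) :
    ∀ n, ∀ G ⊆ H, G.card = n → ¬ Arrow2 G (K3plus k) (tightCycle k (tk k)) := by
  have htk := tk_ge hk
  intro n
  induction n using Nat.strong_induction_on with
  | _ n ih =>
  intro G hG hn hA
  by_cases hne : G.Nonempty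
  swap
  · rw [Finset.not_nonempty_iff_eq_empty] at hne
    subst hne
    rcases hA (fun _ => 0) with ⟨F', hF, hc, _⟩ | ⟨F', hF, hc, _⟩
    · rw [Finset.subset_empty] at hF
      exact (K3_copy_ne hc).ne_empty hF
    · rw [Finset.subset_empty] at hF
      exact (cyc_copy_ne (by omega) hc).ne_empty hF
  obtain ⟨v, hv, hdeg⟩ := exists_low hk hu hm hG hne
  obtain ⟨e0, he0, hve0⟩ := mem_vset.1 hv
  have hlt : (G.filter (fun e => v ∉ e)).card < n := by
    rw [← hn]
    apply Finset.card_lt_card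
    refine ⟨Finset.filter_subset _ _, fun hc => ?_⟩
    exact (Finset.mem_filter.1 (hc he0)).2 hve0
  have ih' := ih _ hlt _ ((Finset.filter_subset _ _).trans hG) rfl
  unfold Arrow2 at ih'
  push Not at ih'
  obtain ⟨χ, hχ0, hχ1⟩ := ih'
  obtain ⟨R, hRS, hRi, hRp⟩ := core_nosd dd_met hk (S := G.filter (fun e => v ∈ e)) hdeg
  rcases hA (fun e => if v ∈ e then (if e ∈ R then 0 else 1) else χ e) with
    ⟨F', hF, hc, hcol⟩ | ⟨F', hF, hc, hcol⟩
  · by_cases hex : ∃ e ∈ F', v ∈ e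
    · obtain ⟨e, he, hve⟩ := hex
      obtain ⟨x, hx, y, hy, hvx, hvy, hxy⟩ := K3_pair hc he hve
      have hin : ∀ z ∈ F', v ∈ z → z ∈ R := by
        intro z hz hvz
        have := hcol z hz
        rw [if_pos hvz] at this
        by_contra hzR
        rw [if_neg hzR] at this
        exact absurd this (by decide)
      exact hRi x (hin x hx hvx) y (hin y hy hvy) hxy
    · push Not at hex
      obtain ⟨e, he, hne'⟩ := hχ0 F' (fun e he => Finset.mem_filter.2 ⟨hF he, hex e he⟩) hc
      have := hcol e he
      rw [if_neg (hex e he)] at this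
      exact hne' this
  · by_cases hex : ∃ e ∈ F', v ∈ e
    · obtain ⟨e, he, hve⟩ := hex
      obtain ⟨p, hp⟩ := cyc_path hk htk hc he hve
      refine hRp p _ (fun z hz => ?_) hp
      rw [Finset.mem_filter] at hz
      refine ⟨Finset.mem_filter.2 ⟨hF hz.1, hz.2⟩, fun hzR => ?_⟩
      have := hcol z hz.1
      rw [if_pos hz.2, if_pos hzR] at this
      exact absurd this (by decide)
    · push Not at hex
      obtain ⟨e, he, hne'⟩ := hχ1 F' (fun e he => Finset.mem_filter.2 ⟨hF he, hex e he⟩) hc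
      have := hcol e he
      rw [if_neg (hex e he)] at this
      exact hne' this

/-- every `k`-uniform hypergraph `H` with `m(H) ≤ m_k(K₃^{+k}, C_{t_k})`
satisfies `H ↛ (K₃^{+k}, C_{t_k})`. -/
theorem property_iv (k : ℕ) (hk : 4 ≤ k) (H : Finset (Finset ℕ))
    (hu : IsUniform k H)
    (hm : mDens H ≤ mkA k (K3plus k) (tightCycle k (tk k))) :
    ¬ Arrow2 H (K3plus k) (tightCycle k (tk k)) := by
  exact main_aux hk hu hm _ H (Finset.Subset.refl _) rfl

end ARR
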